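/- arXiv:1910.07216 — 3 statements merged into one kernel-verified Lean document; each statement's English description precedes it below -/
import Mathlib

section
/- Let f, g, h be three irreducible elements of the maximal ideal 𝔪 of R = ℂ⟦x,y⟧, pairwise non-associated, and assume that each of the quotient rings R/(f,g), R/(g,h), R/(h,f) is a finite-dimensional ℂ-vector space. Set q₁ = I(g,h)/(m(g)·m(h)), q₂ = I(h,f)/(m(h)·m(f)), q₃ = I(f,g)/(m(f)·m(g)) as real numbers. Then, up to a cyclic relabeling, two of these quotients are equal and the third is not smaller than them: (q₁ = q₂ ∧ q₃ ≥ q₁) ∨ (q₂ = q₃ ∧ q₁ ≥ q₂) ∨ (q₃ = q₁ ∧ q₂ ≥ q₃). -/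
local notation "R" => MvPowerSeries (Fin 2) ℂ

/-- The intersection number of two plane curve singularities defined by `f` and `g`. -/
noncomputable def interNum (f g : R) : ℕ :=
  Module.finrank ℂ (R ⧸ Ideal.span {f, g})

/-- The multiplicity of a plane curve singularity defined by `f`: the largest `n`
with `f ∈ 𝔪 ^ n`. -/
noncomputable def mult (f : R) : ℕ :=
  sSup {n : ℕ | f ∈ (IsLocalRing.maximalIdeal R) ^ n}

/-- Two points whose mutual distance is at most their distance to every point of `s` have the same
product of ultrametric distances to the points of `s`. -/
lemma Multiset.prod_map_dist_eq {L : Type*} (w : L → L → ℝ)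
    (hsymm : ∀ x y, w x y = w y x) (hult : ∀ x y z, w x z ≤ max (w x y) (w y z))
    (s : Multiset L) {b c : L} (hb : ∀ a ∈ s, w b c ≤ w a b) (hc : ∀ a ∈ s, w b c ≤ w a c) :
    (s.map fun a => w b a).prod = (s.map fun a => w c a).prod := by
  refine congrArg _ (Multiset.map_congr rfl fun a ha => ?_)
  rw [hsymm b a, hsymm c a]
  apply le_antisymm
  · refine (hult a c b).trans (max_le le_rfl ?_)
    rw [hsymm c b]; exact hc a ha
  · exact (hult a b c).trans (max_le le_rfl (hb a ha))

lemma exists_closest_pair {L : Type*} (w : L → L → ℝ) {s t : Multiset L} (hs : s ≠ 0)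
    (ht : t ≠ 0) :
    ∃ a ∈ s, ∃ b ∈ t, ∀ a' ∈ s, ∀ b' ∈ t, w a b ≤ w a' b' := by
  classical
  have hne : (s.toFinset ×ˢ t.toFinset).Nonempty := by
    obtain ⟨a, ha⟩ := Multiset.exists_mem_of_ne_zero hs
    obtain ⟨b, hb⟩ := Multiset.exists_mem_of_ne_zero ht
    exact ⟨(a, b), by simp [ha, hb]⟩
  obtain ⟨p, hp, hmin⟩ := Finset.exists_min_image _ (fun p => w p.1 p.2) hne
  simp only [Finset.mem_product, Multiset.mem_toFinset] at hp hmin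
  exact ⟨p.1, hp.1, p.2, hp.2, fun a' ha' b' hb' => hmin (a', b') ⟨ha', hb'⟩⟩

/-- If `b₀ ∈ G` and `c₀ ∈ H` are at most as far apart as any point of `F` is from `G` and `H`, then
`b₀` and `c₀` have the same product of distances to `F`, and the points of `G` are at least as close
to `H` as the points of `F` are. -/
lemma prod_dist_ultrametric {L : Type*} (w : L → L → ℝ)
    (h0 : ∀ x y, 0 ≤ w x y)
    (hsymm : ∀ x y, w x y = w y x) (hult : ∀ x y z, w x z ≤ max (w x y) (w y z))
    {F G H : Multiset L} (hF : F ≠ 0) (hH : H ≠ 0)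
    (hconj : ∀ c ∈ H, ∀ c' ∈ H, ∀ b ∈ G, ∃ b' ∈ G, w b' c' = w b c)
    {b₀ c₀ : L} (hb₀ : b₀ ∈ G) (hc₀ : c₀ ∈ H)
    (hFG : ∀ a ∈ F, ∀ b ∈ G, w b₀ c₀ ≤ w a b) (hFH : ∀ a ∈ F, ∀ c ∈ H, w b₀ c₀ ≤ w a c) :
    (F.map fun a => w b₀ a).prod = (F.map fun a => w c₀ a).prod ∧
    ∃ a ∈ F, ∃ b ∈ G, (H.map fun c => w b c).prod ≤ (H.map fun c => w a c).prod := by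
  refine ⟨Multiset.prod_map_dist_eq w hsymm hult F (fun a ha => hFG a ha _ hb₀)
    (fun a ha => hFH a ha _ hc₀), ?_⟩
  obtain ⟨a, ha, c, hc, hac⟩ := exists_closest_pair w hF hH
  obtain ⟨b, hb, hbc⟩ := hconj c₀ hc₀ c hc b₀ hb₀
  refine ⟨a, ha, b, hb, Multiset.prod_map_le_prod_map₀ _ _ (fun c' _ => h0 _ _) fun c' hc' => ?_⟩
  refine (hult b a c').trans (max_le ?_ le_rfl)
  refine (hult b c a).trans (max_le ?_ ?_)
  · rw [hbc]; exact hFH a ha c' hc'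
  · rw [hsymm c a]; exact hac a ha c' hc'

/-- The product of the distances from a point of either multiset to the points `t` of the other one
is `c ^ (card t * q)`. -/
structure HasContact {L : Type*} (w : L → L → ℝ) (c : ℝ) (s t : Multiset L) (q : ℝ) : Prop where
  left : ∀ a ∈ s, (t.map fun b => w a b).prod = c ^ (t.card * q)
  right : ∀ b ∈ t, (s.map fun a => w b a).prod = c ^ (s.card * q)

lemma HasContact.symm {L : Type*} {w : L → L → ℝ} {c : ℝ} {s t : Multiset L} {q : ℝ}
    (h : HasContact w c s t q) : HasContact w c t s q :=
  ⟨h.right, h.left⟩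

lemma HasContact.eq_and_le {L : Type*} {w : L → L → ℝ}
    (h0 : ∀ x y, 0 ≤ w x y)
    (hsymm : ∀ x y, w x y = w y x) (hult : ∀ x y z, w x z ≤ max (w x y) (w y z))
    {F G H : Multiset L} (hF : F ≠ 0) (hH : H ≠ 0)
    (hconj : ∀ c ∈ H, ∀ c' ∈ H, ∀ b ∈ G, ∃ b' ∈ G, w b' c' = w b c)
    {c q₁ q₂ q₃ : ℝ} (hc0 : 0 < c) (hc1 : c < 1) (h₁ : HasContact w c G H q₁)
    (h₂ : HasContact w c H F q₂) (h₃ : HasContact w c F G q₃)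
    {b₀ c₀ : L} (hb₀ : b₀ ∈ G) (hc₀ : c₀ ∈ H)
    (hFG : ∀ a ∈ F, ∀ b ∈ G, w b₀ c₀ ≤ w a b) (hFH : ∀ a ∈ F, ∀ c ∈ H, w b₀ c₀ ≤ w a c) :
    q₂ = q₃ ∧ q₂ ≤ q₁ := by
  have hFpos : (0 : ℝ) < F.card := by exact_mod_cast Multiset.card_pos.2 hF
  have hHpos : (0 : ℝ) < H.card := by exact_mod_cast Multiset.card_pos.2 hH
  obtain ⟨heq, a, ha, b, hb, hle⟩ :=
    prod_dist_ultrametric w h0 hsymm hult hF hH hconj hb₀ hc₀ hFG hFH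
  rw [h₃.right _ hb₀, h₂.left _ hc₀] at heq
  rw [h₁.left _ hb, h₂.right _ ha, Real.rpow_le_rpow_left_iff_of_base_lt_one hc0 hc1] at hle
  refine ⟨?_, le_of_mul_le_mul_left hle hHpos⟩
  exact (mul_left_cancel₀ hFpos.ne' (Real.rpow_right_inj hc0 hc1.ne |>.1 heq)).symm

lemma HasContact.trichotomy {L : Type*} {w : L → L → ℝ}
    (h0 : ∀ x y, 0 ≤ w x y)
    (hsymm : ∀ x y, w x y = w y x) (hult : ∀ x y z, w x z ≤ max (w x y) (w y z))
    {F G H : Multiset L} (hF : F ≠ 0) (hG : G ≠ 0) (hH : H ≠ 0)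
    (hGH : ∀ c ∈ H, ∀ c' ∈ H, ∀ b ∈ G, ∃ b' ∈ G, w b' c' = w b c)
    (hHF : ∀ c ∈ F, ∀ c' ∈ F, ∀ b ∈ H, ∃ b' ∈ H, w b' c' = w b c)
    (hFG : ∀ c ∈ G, ∀ c' ∈ G, ∀ b ∈ F, ∃ b' ∈ F, w b' c' = w b c)
    {c q₁ q₂ q₃ : ℝ} (hc0 : 0 < c) (hc1 : c < 1) (h₁ : HasContact w c G H q₁)
    (h₂ : HasContact w c H F q₂) (h₃ : HasContact w c F G q₃) :
    (q₁ = q₂ ∧ q₁ ≤ q₃) ∨ (q₂ = q₃ ∧ q₂ ≤ q₁) ∨ (q₃ = q₁ ∧ q₃ ≤ q₂) := by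
  obtain ⟨b₁, hb₁, c₁, hc₁, m₁⟩ := exists_closest_pair w hG hH
  obtain ⟨b₂, hb₂, c₂, hc₂, m₂⟩ := exists_closest_pair w hH hF
  obtain ⟨b₃, hb₃, c₃, hc₃, m₃⟩ := exists_closest_pair w hF hG
  have swap : ∀ {s t : Multiset L} {r r' : ℝ}, r' ≤ r → (∀ a ∈ s, ∀ b ∈ t, r ≤ w a b) →
      ∀ b ∈ t, ∀ a ∈ s, r' ≤ w b a :=
    fun hr h b hb a ha => hr.trans ((h a ha b hb).trans_eq (hsymm a b))
  have weaken : ∀ {s t : Multiset L} {r r' : ℝ}, r' ≤ r → (∀ a ∈ s, ∀ b ∈ t, r ≤ w a b) →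
      ∀ a ∈ s, ∀ b ∈ t, r' ≤ w a b :=
    fun hr h a ha b hb => hr.trans (h a ha b hb)
  rcases le_total (w b₁ c₁) (w b₂ c₂) with h12 | h12
  · rcases le_total (w b₁ c₁) (w b₃ c₃) with h13 | h13
    · exact .inr (.inl (HasContact.eq_and_le h0 hsymm hult hF hH hGH hc0 hc1 h₁ h₂ h₃ hb₁ hc₁
        (weaken h13 m₃) (swap h12 m₂)))
    · exact .inl (HasContact.eq_and_le h0 hsymm hult hH hG hFG hc0 hc1 h₃ h₁ h₂ hb₃ hc₃
        (weaken (h13.trans h12) m₂) (swap h13 m₁))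
  · rcases le_total (w b₂ c₂) (w b₃ c₃) with h23 | h23
    · exact .inr (.inr (HasContact.eq_and_le h0 hsymm hult hG hF hHF hc0 hc1 h₂ h₃ h₁ hb₂ hc₂
        (weaken h12 m₁) (swap h23 m₃)))
    · exact .inl (HasContact.eq_and_le h0 hsymm hult hH hG hFG hc0 hc1 h₃ h₁ h₂ hb₃ hc₃
        (weaken h23 m₂) (swap (h23.trans h12) m₁))

lemma PowerSeries.exists_X_pow_mul_unit {k : Type*} [Field k] {a : PowerSeries k} (ha : a ≠ 0) :
    ∃ u : (PowerSeries k)ˣ, a = PowerSeries.X ^ a.order.toNat * (u : PowerSeries k) :=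
  ⟨PowerSeries.Unit_of_divided_by_X_pow_order a, by
    rw [PowerSeries.Unit_of_divided_by_X_pow_order_nonzero ha,
      PowerSeries.X_pow_order_mul_divXPowOrder]⟩

lemma PowerSeries.finrank_quotient_X_pow (k : Type*) [Field k] (n : ℕ) :
    FiniteDimensional k (PowerSeries k ⧸ Ideal.span {(PowerSeries.X : PowerSeries k) ^ n}) ∧
    Module.finrank k (PowerSeries k ⧸ Ideal.span {(PowerSeries.X : PowerSeries k) ^ n}) = n := by
  let φ : PowerSeries k →ₗ[k] (Fin n → k) := LinearMap.pi fun i => PowerSeries.coeff (i : ℕ)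
  have hker : LinearMap.ker φ =
      (Ideal.span {(PowerSeries.X : PowerSeries k) ^ n}).restrictScalars k := by
    ext a
    rw [Submodule.restrictScalars_mem, Ideal.mem_span_singleton, PowerSeries.X_pow_dvd_iff,
      LinearMap.mem_ker, funext_iff]
    exact ⟨fun h m hm => h ⟨m, hm⟩, fun h i => h i i.2⟩
  have hsurj : Function.Surjective φ := fun v =>
    ⟨PowerSeries.mk fun m => if h : m < n then v ⟨m, h⟩ else 0, by ext i; simp [φ]⟩
  let e : (PowerSeries k ⧸ Ideal.span {(PowerSeries.X : PowerSeries k) ^ n}) ≃ₗ[k] (Fin n → k) :=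
    (Submodule.Quotient.restrictScalarsEquiv k _).symm.trans
      ((Submodule.quotEquivOfEq _ _ hker.symm).trans (φ.quotKerEquivOfSurjective hsurj))
  exact ⟨e.symm.finiteDimensional, by rw [e.finrank_eq, Module.finrank_fin_fun]⟩

lemma PowerSeries.finrank_quotient_span {k : Type*} [Field k] {a : PowerSeries k} (ha : a ≠ 0) :
    FiniteDimensional k (PowerSeries k ⧸ Ideal.span {a}) ∧
    Module.finrank k (PowerSeries k ⧸ Ideal.span {a}) = a.order.toNat := by
  obtain ⟨u, hu⟩ := PowerSeries.exists_X_pow_mul_unit ha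
  have : Ideal.span {a} = Ideal.span {(PowerSeries.X : PowerSeries k) ^ a.order.toNat} :=
    Ideal.span_singleton_eq_span_singleton.2 (Associated.symm ⟨u, hu.symm⟩)
  rw [this]
  exact PowerSeries.finrank_quotient_X_pow k _

/-- Over `k⟦X⟧`, the colength of a principal ideal is the order of the norm of a generator: the
power series analogue of `finrank_quotient_span_eq_natDegree_norm`. -/
lemma PowerSeries.finrank_quotient_span_eq_order_norm {k S ι : Type*} [Field k] [CommRing S]
    [IsDomain S] [Algebra (PowerSeries k) S] [Algebra k S] [IsScalarTower k (PowerSeries k) S]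
    [Finite ι] (b : Module.Basis ι (PowerSeries k) S) {f : S} (hf : f ≠ 0) :
    Module.finrank k (S ⧸ Ideal.span {f}) = (Algebra.norm (PowerSeries k) f).order.toNat := by
  have := Fintype.ofFinite ι
  have h := Ideal.span_singleton_eq_bot.not.2 hf
  have h0 := fun i => Ideal.smithCoeffs_ne_zero b _ h i
  have hfin := fun i => (PowerSeries.finrank_quotient_span (h0 i)).1
  have hprod : ∀ s : Finset ι, (∏ i ∈ s, Ideal.smithCoeffs b _ h i).order.toNat =
      ∑ i ∈ s, (Ideal.smithCoeffs b _ h i).order.toNat := by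
    intro s
    classical
    induction s using Finset.induction_on with
    | empty => simp
    | insert i s hi ih =>
      rw [Finset.prod_insert hi, Finset.sum_insert hi, PowerSeries.order_mul, ENat.toNat_add, ih]
      · simp [PowerSeries.order_eq_top]
      · simp [PowerSeries.order_eq_top, Finset.prod_eq_zero_iff]
  obtain ⟨u, hu⟩ := associated_norm_prod_smith b hf
  have hN : (Algebra.norm (PowerSeries k) f).order = (∏ i, Ideal.smithCoeffs b _ h i).order := by
    rw [← hu, PowerSeries.order_mul, PowerSeries.order_zero_of_unit u.isUnit, add_zero]
  rw [hN, hprod, Ideal.finrank_quotient_eq_sum k h b]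
  exact Finset.sum_congr rfl fun i _ => (PowerSeries.finrank_quotient_span (h0 i)).2

/-- A conjugation-invariant ultrametric absolute value on an algebraic extension. -/
structure IsInvariantAbs (K : Type*) {L : Type*} [Field K] [Field L] [Algebra K L] (w : L → ℝ) :
    Prop where
  nonneg : ∀ x, 0 ≤ w x
  one : w 1 = 1
  mul : ∀ x y, w (x * y) = w x * w y
  sub_comm : ∀ x y, w (x - y) = w (y - x)
  ultra : ∀ x y z, w (x - z) ≤ max (w (x - y)) (w (y - z))
  conj : ∀ (σ : L ≃ₐ[K] L) x, w (σ x) = w x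

lemma isInvariantAbs_spectralNorm (K L : Type*) [NontriviallyNormedField K] [IsUltrametricDist K]
    [CompleteSpace K] [Field L] [Algebra K L] [Algebra.IsAlgebraic K L] :
    IsInvariantAbs K (spectralNorm K L) where
  nonneg := spectralNorm_nonneg
  one := spectralNorm_one
  mul := fun x y => spectralAlgNorm_mul x y
  sub_comm x y := by
    rw [← spectralNorm_neg (Algebra.IsAlgebraic.isAlgebraic _), neg_sub]
  ultra x y z := by
    rw [← sub_add_sub_cancel x y z]
    exact isNonarchimedean_spectralNorm _ _
  conj σ x := (spectralNorm_eq_of_equiv σ x).symm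

lemma exists_invariantAbs_laurentSeries (k L : Type*) [Field k] [Field L]
    [Algebra (LaurentSeries k) L] [Algebra.IsAlgebraic (LaurentSeries k) L] :
    ∃ (w : L → ℝ), IsInvariantAbs (LaurentSeries k) w ∧
      0 < w (algebraMap (LaurentSeries k) L (algebraMap (PowerSeries k) _ PowerSeries.X)) ∧
      w (algebraMap (LaurentSeries k) L (algebraMap (PowerSeries k) _ PowerSeries.X)) < 1 ∧
      ∀ u : PowerSeries k,
        w (algebraMap (LaurentSeries k) L (algebraMap (PowerSeries k) _ u)) ≤ 1 := by
  let v : Valuation (LaurentSeries k) (WithZero (Multiplicative ℤ)) := Valued.v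
  have hX : v (algebraMap (PowerSeries k) _ PowerSeries.X) = WithZero.exp (-1 : ℤ) := by
    have := LaurentSeries.valuation_X_pow k 1
    simpa using this
  have hX1 : v (algebraMap (PowerSeries k) _ PowerSeries.X) < 1 := by
    rw [hX, ← WithZero.exp_zero, WithZero.exp_lt_exp]; norm_num
  have hX0 : v (algebraMap (PowerSeries k) _ PowerSeries.X) ≠ 0 := by
    rw [hX]; exact WithZero.exp_ne_zero
  have : v.IsNontrivial := ⟨⟨_, hX0, hX1.ne⟩⟩
  have : v.IsRankOneDiscrete := Valuation.IsRankOneDiscrete.mk' v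
  let : v.RankOne := Valuation.IsRankOneDiscrete.rankOne v (e := 2) (by norm_num)
  let : NontriviallyNormedField (LaurentSeries k) :=
    Valued.toNontriviallyNormedField (LaurentSeries k) (WithZero (Multiplicative ℤ))
  have : IsUltrametricDist (LaurentSeries k) :=
    Valued.instIsUltrametricDist _ (WithZero (Multiplicative ℤ))
  refine ⟨spectralNorm (LaurentSeries k) L, isInvariantAbs_spectralNorm _ _, ?_, ?_, fun u => ?_⟩
  · rw [spectralNorm_extends, norm_pos_iff]
    exact v.ne_zero_iff.1 hX0
  · rw [spectralNorm_extends]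
    exact Valued.toNormedField.norm_lt_one_iff.mpr hX1
  · rw [spectralNorm_extends]
    exact Valued.toNormedField.norm_le_one_iff.mpr
      ((LaurentSeries.val_le_one_iff_eq_coe k _).2 ⟨u, rfl⟩)

lemma IsInvariantAbs.map_pow {K L : Type*} [Field K] [Field L] [Algebra K L] {w : L → ℝ}
    (hw : IsInvariantAbs K w) (x : L) (n : ℕ) : w (x ^ n) = w x ^ n := by
  induction n with
  | zero => simp [hw.one]
  | succ n ih => rw [pow_succ, pow_succ, hw.mul, ih]

lemma IsInvariantAbs.map_powerSeries {k L : Type*} [Field k] [Field L]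
    [Algebra (LaurentSeries k) L] {w : L → ℝ} (hw : IsInvariantAbs (LaurentSeries k) w)
    (h1 : ∀ u : PowerSeries k,
        w (algebraMap (LaurentSeries k) L (algebraMap (PowerSeries k) _ u)) ≤ 1)
    {a : PowerSeries k} (ha : a ≠ 0) :
    w (algebraMap (LaurentSeries k) L (algebraMap (PowerSeries k) _ a)) =
      w (algebraMap (LaurentSeries k) L (algebraMap (PowerSeries k) _ PowerSeries.X)) ^
        a.order.toNat := by
  have hu : ∀ u : (PowerSeries k)ˣ,
      w (algebraMap (LaurentSeries k) L (algebraMap (PowerSeries k) _ u)) = 1 := by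
    intro u
    refine le_antisymm (h1 _) ?_
    rw [← hw.one, ← map_one (algebraMap (LaurentSeries k) L),
      ← map_one (algebraMap (PowerSeries k) (LaurentSeries k)), ← u.mul_inv, map_mul, map_mul,
      hw.mul]
    exact mul_le_of_le_one_right (hw.nonneg _) (h1 _)
  obtain ⟨u, hau⟩ := PowerSeries.exists_X_pow_mul_unit ha
  conv_lhs => rw [hau, map_mul, map_mul, hw.mul, hu, mul_one, _root_.map_pow, _root_.map_pow,
    hw.map_pow]

lemma AdjoinRoot.map_norm_mk {A K : Type*} [CommRing A] [CommRing K] [Nontrivial K] (φ : A →+* K)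
    {P : Polynomial A} (hP : P.Monic) (Q : Polynomial A) :
    φ (Algebra.norm A (AdjoinRoot.mk P Q)) =
      Algebra.norm K (AdjoinRoot.mk (P.map φ) (Q.map φ)) := by
  classical
  have hd : (P.map φ).natDegree = P.natDegree := hP.natDegree_map φ
  rw [Algebra.norm_eq_matrix_det (AdjoinRoot.powerBasisAux' hP),
    Algebra.norm_eq_matrix_det ((AdjoinRoot.powerBasisAux' (hP.map φ)).reindex (finCongr hd)),
    RingHom.map_det]
  congr 1
  ext i j
  have e1 : AdjoinRoot.powerBasisAux' hP j = AdjoinRoot.mk P (Polynomial.X ^ (j : ℕ)) := by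
    rw [map_pow, AdjoinRoot.mk_X]
    exact (AdjoinRoot.powerBasis' hP).basis_eq_pow j
  have e2 : AdjoinRoot.powerBasisAux' (hP.map φ) ((finCongr hd).symm j) =
      AdjoinRoot.mk (P.map φ) (Polynomial.X ^ (j : ℕ)) := by
    rw [map_pow, AdjoinRoot.mk_X]
    exact (AdjoinRoot.powerBasis' (hP.map φ)).basis_eq_pow ((finCongr hd).symm j)
  rw [RingHom.mapMatrix_apply, Matrix.map_apply, Algebra.leftMulMatrix_eq_repr_mul,
    Algebra.leftMulMatrix_eq_repr_mul, Module.Basis.reindex_apply, Module.Basis.repr_reindex_apply,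
    e1, e2, ← map_mul, ← map_mul, AdjoinRoot.powerBasisAux'_repr_apply_to_fun,
    AdjoinRoot.powerBasisAux'_repr_apply_to_fun, AdjoinRoot.modByMonicHom_mk,
    AdjoinRoot.modByMonicHom_mk]
  rw [show Q.map φ * Polynomial.X ^ (j : ℕ) = (Q * Polynomial.X ^ (j : ℕ)).map φ by simp,
    ← Polynomial.map_modByMonic φ hP, Polynomial.coeff_map]
  rfl

lemma exists_algEquiv_of_mem_aroots {K L : Type*} [Field K] [Field L] [Algebra K L] [Normal K L]
    {P : Polynomial K} (hP : Irreducible P) {α β : L} (hα : α ∈ P.aroots L) (hβ : β ∈ P.aroots L) :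
    ∃ σ : L ≃ₐ[K] L, σ α = β := by
  have h : IsConjRoot K β α := by
    rw [Polynomial.mem_aroots] at hα hβ
    rw [isConjRoot_def, ← minpoly.eq_of_irreducible hP hα.2, ← minpoly.eq_of_irreducible hP hβ.2]
  exact h.exists_algEquiv

lemma norm_adjoinRoot_mk_eq_pow {K L : Type*} [Field K] [CharZero K] [Field L] [Algebra K L]
    [IsAlgClosed L] [Normal K L] {w : L → ℝ} (h1 : w 1 = 1) (hmul : ∀ x y, w (x * y) = w x * w y)
    (hconj : ∀ (σ : L ≃ₐ[K] L) x, w (σ x) = w x)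
    {P : Polynomial K} (hP : Irreducible P) (Q : Polynomial K) {α : L} (hα : α ∈ P.aroots L) :
    w (algebraMap K L (Algebra.norm K (AdjoinRoot.mk P Q))) =
      w (Polynomial.aeval α Q) ^ P.natDegree := by
  have := Fact.mk hP
  have hfin : FiniteDimensional K (AdjoinRoot P) := (AdjoinRoot.powerBasis hP.ne_zero).finite
  have hdim : Module.finrank K (AdjoinRoot P) = P.natDegree :=
    (AdjoinRoot.powerBasis hP.ne_zero).finrank
  let W : L →* ℝ := { toFun := w, map_one' := h1, map_mul' := hmul }
  rw [Algebra.norm_eq_prod_embeddings K L]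
  change W _ = _
  rw [map_prod, Finset.prod_congr rfl (g := fun _ => w (Polynomial.aeval α Q)),
    Finset.prod_const, Finset.card_univ, AlgHom.card, hdim]
  intro σ _
  have hr : σ (AdjoinRoot.root P) ∈ P.aroots L := by
    rw [Polynomial.mem_aroots]
    refine ⟨hP.ne_zero, ?_⟩
    rw [Polynomial.aeval_algHom_apply, AdjoinRoot.aeval_eq, AdjoinRoot.mk_self, map_zero]
  obtain ⟨τ, hτ⟩ := exists_algEquiv_of_mem_aroots hP hα hr
  change w _ = _
  rw [← AdjoinRoot.aeval_eq, ← Polynomial.aeval_algHom_apply, ← hτ]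
  exact (congrArg w (Polynomial.aeval_algHom_apply τ α Q)).trans (hconj τ _)

lemma PowerSeries.isAdicComplete_maximalIdeal (k : Type*) [Field k] :
    IsAdicComplete (IsLocalRing.maximalIdeal (PowerSeries k)) (PowerSeries k) := by
  rw [PowerSeries.maximalIdeal_eq_span_X]
  infer_instance

/-- A power series `F` is equivalent to a polynomial `P`: they are associated, `P` is monic, and
division by `F` reduces to division by `P`. -/
structure IsWeierstrassPolynomial {A : Type*} [CommRing A] (F : PowerSeries A)
    (P : Polynomial A) : Prop where
  monic : P.Monic
  associated : Associated (P : PowerSeries A) F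
  equiv : ∃ e : (Polynomial A ⧸ Ideal.span {P}) ≃ₐ[A] (PowerSeries A ⧸ Ideal.span {F}),
    ∀ Q : Polynomial A, e (Ideal.Quotient.mk _ Q) = Ideal.Quotient.mk _ (Q : PowerSeries A)

lemma IsWeierstrassPolynomial.irreducible {A : Type*} [CommRing A] [IsDomain A]
    {F : PowerSeries A} {P : Polynomial A} (h : IsWeierstrassPolynomial F P) (hF : Prime F) :
    Irreducible P := by
  obtain ⟨e, -⟩ := h.equiv
  have h1 : (Ideal.span {F}).IsPrime := (Ideal.span_singleton_prime hF.ne_zero).2 hF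
  have h2 : IsDomain (Polynomial A ⧸ Ideal.span {P}) := e.toMulEquiv.isDomain _
  rw [Ideal.Quotient.isDomain_iff_prime, Ideal.span_singleton_prime h.monic.ne_zero] at h2
  exact h2.irreducible

lemma exists_isWeierstrassPolynomial {k : Type*} [Field k] {F : PowerSeries (PowerSeries k)}
    (hF : F.map (IsLocalRing.residue (PowerSeries k)) ≠ 0) :
    ∃ P, IsWeierstrassPolynomial F P ∧
      P.natDegree = (F.map (IsLocalRing.residue (PowerSeries k))).order.toNat := by
  have := PowerSeries.isAdicComplete_maximalIdeal k
  obtain ⟨P, u, H⟩ := F.exists_isWeierstrassFactorization hF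
  refine ⟨P, ⟨H.isDistinguishedAt.monic, ⟨H.isUnit.unit, H.eq_mul.symm⟩, H.algEquivQuotient,
    fun Q => ?_⟩, H.natDegree_eq_toNat_order_map⟩
  simp

lemma IsWeierstrassPolynomial.finrank_quotient_span_pair (k : Type*) {A : Type*} [Field k]
    [CommRing A] [Algebra k A] {F G : PowerSeries A} {P Q : Polynomial A}
    (hP : IsWeierstrassPolynomial F P) (hQ : Associated (Q : PowerSeries A) G) :
    Module.finrank k (PowerSeries A ⧸ Ideal.span {F, G}) =
      Module.finrank k (AdjoinRoot P ⧸ Ideal.span {AdjoinRoot.mk P Q}) := by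
  obtain ⟨e, he⟩ := hP.equiv
  have h1 : Ideal.span {F, G} = Ideal.span {F} ⊔ Ideal.span {(Q : PowerSeries A)} := by
    obtain ⟨u, rfl⟩ := hQ
    rw [Ideal.span_insert, Ideal.span_singleton_mul_right_unit u.isUnit]
  let e1 := (Ideal.quotientEquivAlgOfEq k h1).trans
    (DoubleQuot.quotQuotEquivQuotSupₐ k _ _).symm
  let e2 : (AdjoinRoot P ⧸ Ideal.span {AdjoinRoot.mk P Q}) ≃ₐ[k] _ :=
    Ideal.quotientEquivAlg (Ideal.span {AdjoinRoot.mk P Q})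
      ((Ideal.span {(Q : PowerSeries A)}).map
        (Ideal.Quotient.mkₐ k (Ideal.span {F}))) (e.restrictScalars k) (by
      rw [Ideal.map_span, Ideal.map_span, Set.image_singleton, Set.image_singleton]
      congr 2
      exact (he Q).symm)
  exact (e1.trans e2.symm).toLinearEquiv.finrank_eq

lemma IsWeierstrassPolynomial.finrank_quotient_eq_order_norm {k : Type*} [Field k]
    {F G : PowerSeries (PowerSeries k)} {P Q : Polynomial (PowerSeries k)} (hF : Prime F)
    (hP : IsWeierstrassPolynomial F P) (hQ : Associated (Q : PowerSeries (PowerSeries k)) G)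
    (hPQ : ¬ P ∣ Q) :
    Algebra.norm (PowerSeries k) (AdjoinRoot.mk P Q) ≠ 0 ∧
    Module.finrank k (PowerSeries (PowerSeries k) ⧸ Ideal.span {F, G}) =
      (Algebra.norm (PowerSeries k) (AdjoinRoot.mk P Q)).order.toNat := by
  have hdom : IsDomain (AdjoinRoot P) := AdjoinRoot.isDomain_of_prime (hP.irreducible hF).prime
  have hne : AdjoinRoot.mk P Q ≠ 0 := by rwa [Ne, AdjoinRoot.mk_eq_zero]
  have b := AdjoinRoot.powerBasisAux' hP.monic
  refine ⟨(Algebra.norm_ne_zero_iff_of_basis b).2 hne, ?_⟩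
  rw [← PowerSeries.finrank_quotient_span_eq_order_norm (k := k) b hne]
  exact hP.finrank_quotient_span_pair k hQ

lemma IsWeierstrassPolynomial.not_dvd {A : Type*} [CommRing A] [IsDomain A] {F G : PowerSeries A}
    {P Q : Polynomial A} (hP : IsWeierstrassPolynomial F P) (hQ : IsWeierstrassPolynomial G Q)
    (hF : Prime F) (hG : Prime G) (hFG : ¬ Associated F G) : ¬ P ∣ Q := by
  intro h
  have hPQ : Associated P Q :=
    (hP.irreducible hF).dvd_irreducible_iff_associated (hQ.irreducible hG) |>.1 h
  rw [Polynomial.eq_of_monic_of_associated hP.monic hQ.monic hPQ] at hP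
  exact hFG (hP.associated.symm.trans hQ.associated)

lemma aeval_eq_prod_sub_aroots {K L : Type*} [Field K] [Field L] [Algebra K L]
    [IsAlgClosed L] {w : L → ℝ} (hw : IsInvariantAbs K w) {Q : Polynomial K} (hQ : Q.Monic)
    (α : L) :
    w (Polynomial.aeval α Q) = ((Q.aroots L).map fun β => w (α - β)).prod := by
  let W : L →* ℝ := { toFun := w, map_one' := hw.one, map_mul' := hw.mul }
  rw [(IsAlgClosed.splits (Q.map (algebraMap K L))).aeval_eq_prod_aroots_of_monic hQ]
  change W _ = _
  rw [map_multiset_prod, Multiset.map_map]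
  rfl

lemma IsWeierstrassPolynomial.prod_dist_eq {k L : Type*} [Field k] [CharZero k] [Field L]
    [Algebra (LaurentSeries k) L] [IsAlgClosed L] [Normal (LaurentSeries k) L] {w : L → ℝ}
    (hw : IsInvariantAbs (LaurentSeries k) w)
    (hX : 0 < w (algebraMap (LaurentSeries k) L (algebraMap (PowerSeries k) _ PowerSeries.X)))
    (h1 : ∀ u : PowerSeries k,
      w (algebraMap (LaurentSeries k) L (algebraMap (PowerSeries k) _ u)) ≤ 1)
    {F G : PowerSeries (PowerSeries k)} {P Q : Polynomial (PowerSeries k)} (hF : Prime F)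
    (hG : Prime G) (hP : IsWeierstrassPolynomial F P) (hQ : IsWeierstrassPolynomial G Q)
    (hFG : ¬ Associated F G) {α : L}
    (hα : α ∈ (P.map (algebraMap (PowerSeries k) (LaurentSeries k))).aroots L) :
    (((Q.map (algebraMap (PowerSeries k) (LaurentSeries k))).aroots L).map
      fun β => w (α - β)).prod =
    w (algebraMap (LaurentSeries k) L (algebraMap (PowerSeries k) _ PowerSeries.X)) ^
      ((Module.finrank k (PowerSeries (PowerSeries k) ⧸ Ideal.span {F, G}) : ℝ) / P.natDegree) := by
  obtain ⟨hN, hI⟩ := IsWeierstrassPolynomial.finrank_quotient_eq_order_norm hF hP hQ.associated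
    (hP.not_dvd hQ hF hG hFG)
  have hPK := hP.monic.irreducible_iff_irreducible_map_fraction_map (K := LaurentSeries k) |>.1
    (hP.irreducible hF)
  have hdeg := hP.monic.natDegree_map (algebraMap (PowerSeries k) (LaurentSeries k))
  have hpos : 0 < P.natDegree := by
    rw [← hdeg]; exact hPK.natDegree_pos
  have : CharZero (LaurentSeries k) :=
    charZero_of_injective_algebraMap (algebraMap k (LaurentSeries k)).injective
  have key := norm_adjoinRoot_mk_eq_pow hw.one hw.mul hw.conj hPK
    (Q.map (algebraMap (PowerSeries k) (LaurentSeries k))) hα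
  rw [← AdjoinRoot.map_norm_mk _ hP.monic, hw.map_powerSeries h1 hN, ← hI,
    aeval_eq_prod_sub_aroots hw (hQ.monic.map _), hdeg] at key
  rw [div_eq_mul_inv, Real.rpow_mul hX.le, Real.rpow_natCast, key,
    Real.pow_rpow_inv_natCast _ hpos.ne']
  exact Multiset.prod_map_nonneg fun β _ => hw.nonneg _

lemma IsWeierstrassPolynomial.hasContact {k L : Type*} [Field k] [CharZero k] [Field L]
    [Algebra (LaurentSeries k) L] [IsAlgClosed L] [Normal (LaurentSeries k) L] {w : L → ℝ}
    (hw : IsInvariantAbs (LaurentSeries k) w)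
    (hX : 0 < w (algebraMap (LaurentSeries k) L (algebraMap (PowerSeries k) _ PowerSeries.X)))
    (h1 : ∀ u : PowerSeries k,
      w (algebraMap (LaurentSeries k) L (algebraMap (PowerSeries k) _ u)) ≤ 1)
    {F G : PowerSeries (PowerSeries k)} {P Q : Polynomial (PowerSeries k)} (hF : Prime F)
    (hG : Prime G) (hP : IsWeierstrassPolynomial F P) (hQ : IsWeierstrassPolynomial G Q)
    (hFG : ¬ Associated F G) :
    HasContact (fun a b => w (a - b))
      (w (algebraMap (LaurentSeries k) L (algebraMap (PowerSeries k) _ PowerSeries.X)))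
      ((P.map (algebraMap (PowerSeries k) (LaurentSeries k))).aroots L)
      ((Q.map (algebraMap (PowerSeries k) (LaurentSeries k))).aroots L)
      ((Module.finrank k (PowerSeries (PowerSeries k) ⧸ Ideal.span {F, G}) : ℝ) /
        (P.natDegree * Q.natDegree)) := by
  have hcard : ∀ {G : PowerSeries (PowerSeries k)} {Q : Polynomial (PowerSeries k)}, Prime G →
      IsWeierstrassPolynomial G Q → 0 < Q.natDegree ∧
      ((Q.map (algebraMap (PowerSeries k) (LaurentSeries k))).aroots L).card = Q.natDegree := by
    intro G Q hG hQ
    have hdeg := hQ.monic.natDegree_map (algebraMap (PowerSeries k) (LaurentSeries k))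
    refine ⟨?_, ?_⟩
    · rw [← hdeg]
      exact (hQ.monic.irreducible_iff_irreducible_map_fraction_map (K := LaurentSeries k) |>.1
        (hQ.irreducible hG)).natDegree_pos
    · rw [IsAlgClosed.card_aroots_eq_natDegree, hdeg]
  obtain ⟨hP0, hPc⟩ := hcard hF hP
  obtain ⟨hQ0, hQc⟩ := hcard hG hQ
  have hP0' : (P.natDegree : ℝ) ≠ 0 := by exact_mod_cast hP0.ne'
  have hQ0' : (Q.natDegree : ℝ) ≠ 0 := by exact_mod_cast hQ0.ne'
  constructor
  · intro α hα
    rw [hP.prod_dist_eq hw hX h1 hF hG hQ hFG hα, hQc]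
    congr 1
    field_simp
  · intro β hβ
    rw [hQ.prod_dist_eq hw hX h1 hG hF hP (fun h => hFG h.symm) hβ, hPc, Set.pair_comm]
    congr 1
    field_simp

lemma trichotomy_finrank_quotient {k : Type*} [Field k] [CharZero k]
    {F G H : PowerSeries (PowerSeries k)} (hF : Prime F) (hG : Prime G) (hH : Prime H)
    (hFG : ¬ Associated F G) (hGH : ¬ Associated G H) (hHF : ¬ Associated H F)
    {P Q T : Polynomial (PowerSeries k)} (hP : IsWeierstrassPolynomial F P)
    (hQ : IsWeierstrassPolynomial G Q) (hT : IsWeierstrassPolynomial H T)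
    {q₁ q₂ q₃ : ℝ}
    (h₁ : q₁ = (Module.finrank k (PowerSeries (PowerSeries k) ⧸ Ideal.span {G, H}) : ℝ) /
        (Q.natDegree * T.natDegree))
    (h₂ : q₂ = (Module.finrank k (PowerSeries (PowerSeries k) ⧸ Ideal.span {H, F}) : ℝ) /
        (T.natDegree * P.natDegree))
    (h₃ : q₃ = (Module.finrank k (PowerSeries (PowerSeries k) ⧸ Ideal.span {F, G}) : ℝ) /
        (P.natDegree * Q.natDegree)) :
    (q₁ = q₂ ∧ q₁ ≤ q₃) ∨ (q₂ = q₃ ∧ q₂ ≤ q₁) ∨ (q₃ = q₁ ∧ q₃ ≤ q₂) := by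
  obtain ⟨w, hw, hX0, hX1, h1⟩ :=
    exists_invariantAbs_laurentSeries k (AlgebraicClosure (LaurentSeries k))
  have hirr : ∀ {G : PowerSeries (PowerSeries k)} {Q : Polynomial (PowerSeries k)}, Prime G →
      IsWeierstrassPolynomial G Q →
      Irreducible (Q.map (algebraMap (PowerSeries k) (LaurentSeries k))) := fun hG hQ =>
    hQ.monic.irreducible_iff_irreducible_map_fraction_map.1 (hQ.irreducible hG)
  have hne : ∀ {G : PowerSeries (PowerSeries k)} {Q : Polynomial (PowerSeries k)}, Prime G →
      IsWeierstrassPolynomial G Q →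
      (Q.map (algebraMap (PowerSeries k) (LaurentSeries k))).aroots
        (AlgebraicClosure (LaurentSeries k)) ≠ 0 := by
    intro G Q hG hQ
    rw [← Multiset.card_pos, IsAlgClosed.card_aroots_eq_natDegree]
    exact (hirr hG hQ).natDegree_pos
  have hconj : ∀ {G : PowerSeries (PowerSeries k)} {Q T : Polynomial (PowerSeries k)}, Prime G →
      IsWeierstrassPolynomial G Q →
      ∀ c ∈ (Q.map (algebraMap (PowerSeries k) (LaurentSeries k))).aroots
        (AlgebraicClosure (LaurentSeries k)),
      ∀ c' ∈ (Q.map (algebraMap (PowerSeries k) (LaurentSeries k))).aroots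
        (AlgebraicClosure (LaurentSeries k)),
      ∀ b ∈ (T.map (algebraMap (PowerSeries k) (LaurentSeries k))).aroots
        (AlgebraicClosure (LaurentSeries k)),
      ∃ b' ∈ (T.map (algebraMap (PowerSeries k) (LaurentSeries k))).aroots
        (AlgebraicClosure (LaurentSeries k)), w (b' - c') = w (b - c) := by
    intro G Q T hG hQ c hc c' hc' b hb
    obtain ⟨σ, rfl⟩ := exists_algEquiv_of_mem_aroots (hirr hG hQ) hc hc'
    refine ⟨σ b, ?_, by rw [← map_sub, hw.conj]⟩
    rw [Polynomial.mem_aroots] at hb ⊢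
    refine ⟨hb.1, ?_⟩
    exact (Polynomial.aeval_algHom_apply σ b _).trans (by rw [hb.2, map_zero])
  subst h₁ h₂ h₃
  exact HasContact.trichotomy (w := fun a b => w (a - b)) (fun _ _ => hw.nonneg _)
    (fun _ _ => hw.sub_comm _ _) (fun _ _ _ => hw.ultra _ _ _) (hne hF hP) (hne hG hQ) (hne hH hT)
    (hconj hH hT) (hconj hF hP) (hconj hG hQ) hX0 hX1
    (hQ.hasContact hw hX0 h1 hG hH hT hGH) (hT.hasContact hw hX0 h1 hH hF hP hHF)
    (hP.hasContact hw hX0 h1 hF hG hQ hFG)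

/-- The change of variables `Y ↦ Y + c X`. -/
lemma MvPowerSeries.exists_shear {k : Type*} [Field k] (c : k) :
    ∃ φ : MvPowerSeries (Fin 2) k ≃ₐ[k] MvPowerSeries (Fin 2) k,
      φ (MvPowerSeries.X 0) = MvPowerSeries.X 0 ∧
      φ (MvPowerSeries.X 1) = MvPowerSeries.X 1 + MvPowerSeries.C c * MvPowerSeries.X 0 := by
  let a : k → Fin 2 → MvPowerSeries (Fin 2) k := fun c =>
    ![MvPowerSeries.X 0, MvPowerSeries.X 1 + MvPowerSeries.C c * MvPowerSeries.X 0]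
  have ha : ∀ c, MvPowerSeries.HasSubst (a c) := fun c =>
    MvPowerSeries.hasSubst_of_constantCoeff_zero fun i => by fin_cases i <;> simp [a]
  let s : k → MvPowerSeries (Fin 2) k →ₐ[k] MvPowerSeries (Fin 2) k := fun c =>
    MvPowerSeries.substAlgHom (ha c)
  have h0 : ∀ c, s c (MvPowerSeries.X 0) = MvPowerSeries.X 0 := fun c =>
    MvPowerSeries.substAlgHom_X (ha c) 0
  have h1 : ∀ c, s c (MvPowerSeries.X 1) =
      MvPowerSeries.X 1 + MvPowerSeries.C c * MvPowerSeries.X 0 := fun c =>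
    MvPowerSeries.substAlgHom_X (ha c) 1
  have hC : ∀ c d, s c (MvPowerSeries.C d) = MvPowerSeries.C d := fun c d =>
    (s c).commutes d
  have hinv : ∀ c d, c + d = 0 → (s c).comp (s d) = AlgHom.id k _ := by
    intro c d hcd
    have key : (fun i => MvPowerSeries.subst (a c) (a d i)) = MvPowerSeries.X := by
      funext i
      rw [← MvPowerSeries.substAlgHom_apply (ha c)]
      fin_cases i
      · exact h0 c
      · change s c (MvPowerSeries.X 1 + MvPowerSeries.C d * MvPowerSeries.X 0) =
          MvPowerSeries.X 1
        rw [map_add, map_mul, h0, h1, hC, add_assoc, ← add_mul, ← map_add, hcd, map_zero, zero_mul,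
          add_zero]
    ext1 f
    change MvPowerSeries.substAlgHom (ha c) (MvPowerSeries.substAlgHom (ha d) f) = f
    rw [MvPowerSeries.substAlgHom_apply, MvPowerSeries.substAlgHom_apply,
      MvPowerSeries.subst_comp_subst_apply (ha d) (ha c), key, MvPowerSeries.subst_self]
    rfl
  exact ⟨AlgEquiv.ofAlgHom _ _ (hinv c (-c) (add_neg_cancel c)) (hinv (-c) c (neg_add_cancel c)),
    h0 c, h1 c⟩

lemma MvPowerSeries.exists_equiv_powerSeries {k : Type*} [Field k] (c : k) :
    ∃ φ : MvPowerSeries (Fin 2) k ≃ₐ[k] PowerSeries (PowerSeries k),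
      φ (MvPowerSeries.X 0) = PowerSeries.X ∧
      φ (MvPowerSeries.X 1) =
        PowerSeries.C PowerSeries.X + algebraMap k _ c * PowerSeries.X := by
  obtain ⟨φ, h0, h1⟩ := MvPowerSeries.exists_shear c
  let e : Fin 2 ≃ Option Unit :=
    ⟨![none, some ()], fun o => o.elim 0 fun _ => 1, fun i => by fin_cases i <;> rfl, fun o => by
      rcases o with _ | _ <;> rfl⟩
  let ψ : MvPowerSeries (Fin 2) k ≃ₐ[k] PowerSeries (PowerSeries k) :=
    (MvPowerSeries.renameEquiv k e).trans (MvPowerSeries.optionEquivLeft Unit k)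
  have g0 : ψ (MvPowerSeries.X 0) = PowerSeries.X := by
    change MvPowerSeries.optionEquivLeft Unit k (MvPowerSeries.rename e (MvPowerSeries.X 0)) = _
    rw [MvPowerSeries.rename_X]
    exact MvPowerSeries.optionEquivLeft_X_none
  have g1 : ψ (MvPowerSeries.X 1) = PowerSeries.C PowerSeries.X := by
    change MvPowerSeries.optionEquivLeft Unit k (MvPowerSeries.rename e (MvPowerSeries.X 1)) = _
    rw [MvPowerSeries.rename_X]
    exact MvPowerSeries.optionEquivLeft_X_some ()
  have gC : ψ (MvPowerSeries.C c) = algebraMap k _ c := ψ.commutes c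
  refine ⟨φ.trans ψ, ?_, ?_⟩
  · rw [AlgEquiv.trans_apply, h0, g0]
  · rw [AlgEquiv.trans_apply, h1, map_add, map_mul, g0, g1, gC]

lemma MvPolynomial.IsHomogeneous.eval_mul_left {σ S : Type*} [CommSemiring S]
    {p : MvPolynomial σ S} {n : ℕ} (hp : p.IsHomogeneous n) (r : S) (x : σ → S) :
    MvPolynomial.eval (fun i => r * x i) p = r ^ n * MvPolynomial.eval x p := by
  rw [MvPolynomial.eval_eq, MvPolynomial.eval_eq, Finset.mul_sum]
  refine Finset.sum_congr rfl fun d hd => ?_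
  simp_rw [mul_pow]
  rw [Finset.prod_mul_distrib, Finset.prod_pow_eq_pow_sum, ← hp.degree_eq_sum_deg_support hd]
  ring

lemma MvPolynomial.eval_mem_mul_pow {σ S : Type*} [CommSemiring S] {p : MvPolynomial σ S} {n : ℕ}
    (hp : p.IsHomogeneous n) {I J : Ideal S} (hI : ∀ d, p.coeff d ∈ I) {x : σ → S}
    (hx : ∀ i, x i ∈ J) : MvPolynomial.eval x p ∈ I * J ^ n := by
  rw [MvPolynomial.eval_eq]
  refine Ideal.sum_mem _ fun d hd => Ideal.mul_mem_mul (hI d) ?_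
  rw [hp.degree_eq_sum_deg_support hd, ← Finset.prod_pow_eq_pow_sum]
  exact Ideal.prod_mem_prod fun i _ => Ideal.pow_mem_pow (hx i) _

lemma MvPowerSeries.maximalIdeal_fin_two (k : Type*) [Field k] :
    IsLocalRing.maximalIdeal (MvPowerSeries (Fin 2) k) =
      Ideal.span (Set.range (MvPowerSeries.X : Fin 2 → MvPowerSeries (Fin 2) k)) := by
  apply le_antisymm
  · obtain ⟨φ, h0, h1⟩ := MvPowerSeries.exists_equiv_powerSeries (0 : k)
    rw [map_zero, zero_mul, add_zero] at h1
    intro f hf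
    have hu : ¬ IsUnit (φ f) := fun h => hf ((MulEquiv.isUnit_map φ).1 h)
    rw [PowerSeries.isUnit_iff_constantCoeff, PowerSeries.isUnit_iff_constantCoeff,
      isUnit_iff_ne_zero, not_not] at hu
    obtain ⟨a, ha⟩ := PowerSeries.X_dvd_iff.2 hu
    have key := PowerSeries.eq_X_mul_shift_add_const (φ f)
    rw [ha, map_mul, ← h0, ← h1] at key
    have key' := congrArg φ.symm key
    rw [map_add, map_mul, map_mul, φ.symm_apply_apply, φ.symm_apply_apply,
      φ.symm_apply_apply] at key'
    rw [key']
    exact Ideal.add_mem _ (Ideal.mul_mem_right _ _ (Ideal.subset_span ⟨0, rfl⟩))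
      (Ideal.mul_mem_right _ _ (Ideal.subset_span ⟨1, rfl⟩))
  · rw [Ideal.span_le]
    rintro _ ⟨i, rfl⟩
    rw [SetLike.mem_coe, IsLocalRing.mem_maximalIdeal, mem_nonunits_iff,
      MvPowerSeries.isUnit_iff_constantCoeff]
    simp

lemma exists_mem_pow_notMem_pow_succ {A : Type*} [CommRing A] [IsLocalRing A] [IsNoetherianRing A]
    {f : A} (hf : f ≠ 0) :
    f ∈ IsLocalRing.maximalIdeal A ^ sSup {n : ℕ | f ∈ IsLocalRing.maximalIdeal A ^ n} ∧
      f ∉ IsLocalRing.maximalIdeal A ^ (sSup {n : ℕ | f ∈ IsLocalRing.maximalIdeal A ^ n} + 1) := by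
  have hb : BddAbove {n : ℕ | f ∈ IsLocalRing.maximalIdeal A ^ n} := by
    by_contra hb
    refine hf ?_
    rw [← Ideal.mem_bot, ← Ideal.iInf_pow_eq_bot_of_isLocalRing (IsLocalRing.maximalIdeal A)
      (Ideal.IsPrime.ne_top'), Ideal.mem_iInf]
    intro n
    obtain ⟨m, hm, hnm⟩ := not_bddAbove_iff.1 hb n
    exact Ideal.pow_le_pow_right hnm.le hm
  refine ⟨Nat.sSup_mem ⟨0, by simp⟩ hb, fun h => ?_⟩
  exact (Nat.lt_succ_self _).not_ge (le_csSup hb (Set.mem_ofPred.2 h))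

/-- The initial form of a nonzero power series in two variables: it determines the lines along
which the order of the series equals its multiplicity. -/
lemma MvPowerSeries.exists_initialForm {k : Type*} [Field k] {f : MvPowerSeries (Fin 2) k}
    (hf : f ≠ 0) :
    ∃ p : MvPolynomial (Fin 2) k, p ≠ 0 ∧
      p.IsHomogeneous (sSup {n : ℕ | f ∈ IsLocalRing.maximalIdeal (MvPowerSeries (Fin 2) k) ^ n}) ∧
      ∀ (c : k) (φ : MvPowerSeries (Fin 2) k ≃ₐ[k] PowerSeries (PowerSeries k)),
        φ (MvPowerSeries.X 0) = PowerSeries.X →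
        φ (MvPowerSeries.X 1) =
          PowerSeries.C PowerSeries.X + algebraMap k _ c * PowerSeries.X →
        MvPolynomial.eval ![1, c] p ≠ 0 →
        ((φ f).map (IsLocalRing.residue (PowerSeries k))).order =
          (sSup {n : ℕ | f ∈ IsLocalRing.maximalIdeal (MvPowerSeries (Fin 2) k) ^ n} : ℕ) := by
  obtain ⟨h1, h2⟩ := exists_mem_pow_notMem_pow_succ hf
  generalize sSup {n : ℕ | f ∈ IsLocalRing.maximalIdeal (MvPowerSeries (Fin 2) k) ^ n} = n at *
  rw [MvPowerSeries.maximalIdeal_fin_two, Ideal.mem_span_pow_iff_exists_isHomogeneous] at h1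
  obtain ⟨p, hp, rfl⟩ := h1
  refine ⟨p.map MvPowerSeries.constantCoeff, fun h0 => h2 ?_, hp.map _, fun c φ hφ0 hφ1 hc => ?_⟩
  · rw [pow_succ']
    refine MvPolynomial.eval_mem_mul_pow hp (fun d => ?_) fun i => ?_
    · rw [IsLocalRing.mem_maximalIdeal, mem_nonunits_iff, MvPowerSeries.isUnit_iff_constantCoeff,
        ← MvPolynomial.coeff_map, h0]
      simp
    · rw [MvPowerSeries.maximalIdeal_fin_two]
      exact Ideal.subset_span ⟨i, rfl⟩
  · let K := IsLocalRing.ResidueField (PowerSeries k)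
    let ι : k →+* K := (IsLocalRing.residue (PowerSeries k)).comp PowerSeries.C
    let π : MvPowerSeries (Fin 2) k →+* PowerSeries K :=
      (PowerSeries.map (IsLocalRing.residue (PowerSeries k))).comp
        (φ : MvPowerSeries (Fin 2) k →+* PowerSeries (PowerSeries k))
    have hπφ : ∀ u, π u = PowerSeries.map (IsLocalRing.residue (PowerSeries k)) (φ u) :=
      fun _ => rfl
    have hπ0 : π (MvPowerSeries.X 0) = PowerSeries.X * 1 := by
      rw [hπφ, hφ0, PowerSeries.map_X, mul_one]
    have hX : IsLocalRing.residue (PowerSeries k) PowerSeries.X = 0 := by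
      rw [IsLocalRing.residue_eq_zero_iff, IsLocalRing.mem_maximalIdeal, mem_nonunits_iff,
        PowerSeries.isUnit_iff_constantCoeff]
      simp
    have hC : ∀ a, algebraMap k (PowerSeries (PowerSeries k)) a =
        PowerSeries.C (PowerSeries.C a) := fun a => by
      rw [PowerSeries.algebraMap_apply, PowerSeries.algebraMap_apply, Algebra.algebraMap_self,
        RingHom.id_apply]
    have hπ1 : π (MvPowerSeries.X 1) = PowerSeries.X * PowerSeries.C (ι c) := by
      rw [hπφ, hφ1, hC, map_add, map_mul, PowerSeries.map_X, PowerSeries.map_C, PowerSeries.map_C,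
        hX, map_zero, zero_add, mul_comm]
      rfl
    have hcc : (PowerSeries.constantCoeff : PowerSeries K →+* K).comp π =
          ι.comp MvPowerSeries.constantCoeff := by
      ext u
      have h3 : PowerSeries.constantCoeff
          (π (u - MvPowerSeries.C (MvPowerSeries.constantCoeff u))) = 0 := by
        rw [hπφ, ← PowerSeries.coeff_zero_eq_constantCoeff_apply, PowerSeries.coeff_map,
          PowerSeries.coeff_zero_eq_constantCoeff_apply, IsLocalRing.residue_eq_zero_iff,
          IsLocalRing.mem_maximalIdeal, mem_nonunits_iff, ← PowerSeries.isUnit_iff_constantCoeff,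
          MulEquiv.isUnit_map φ, MvPowerSeries.isUnit_iff_constantCoeff]
        simp
      have h4 : π (MvPowerSeries.C (MvPowerSeries.constantCoeff u)) =
          PowerSeries.C (ι (MvPowerSeries.constantCoeff u)) := by
        have hφC := φ.commutes (MvPowerSeries.constantCoeff u)
        rw [MvPowerSeries.algebraMap_apply, Algebra.algebraMap_self, RingHom.id_apply, hC] at hφC
        rw [hπφ, hφC]
        exact PowerSeries.map_C _ _
      rw [map_sub, map_sub, h4, PowerSeries.constantCoeff_C, sub_eq_zero] at h3
      exact h3
    have hx : (fun i => π (MvPowerSeries.X i)) =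
        fun i => PowerSeries.X * (![1, PowerSeries.C (ι c)] : Fin 2 → PowerSeries K) i := by
      funext i
      fin_cases i
      · exact hπ0
      · exact hπ1
    have hπ : π (MvPolynomial.eval MvPowerSeries.X p) = PowerSeries.X ^ n *
        MvPolynomial.eval ![1, PowerSeries.C (ι c)] (p.map π) := by
      rw [← (hp.map π).eval_mul_left, ← hx, MvPolynomial.map_eval]
      rfl
    have hU : PowerSeries.constantCoeff
        (MvPolynomial.eval ![1, PowerSeries.C (ι c)] (p.map π)) =
        ι (MvPolynomial.eval ![1, c] (p.map MvPowerSeries.constantCoeff)) := by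
      rw [MvPolynomial.map_eval, MvPolynomial.map_eval, MvPolynomial.map_map, MvPolynomial.map_map,
        hcc]
      congr 2
      funext i
      fin_cases i <;> simp
    have hU' : IsUnit (MvPolynomial.eval ![1, PowerSeries.C (ι c)] (p.map π)) := by
      rw [PowerSeries.isUnit_iff_constantCoeff, hU, isUnit_iff_ne_zero]
      exact (map_ne_zero ι).2 hc
    change (π (MvPolynomial.eval MvPowerSeries.X p)).order = n
    rw [hπ, PowerSeries.order_mul, PowerSeries.order_X_pow, PowerSeries.order_zero_of_unit hU',
      add_zero]

lemma MvPolynomial.exists_eval_one_ne_zero {k : Type*} [Field k] [Infinite k] {n₁ n₂ n₃ : ℕ}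
    {p₁ p₂ p₃ : MvPolynomial (Fin 2) k} (h₁ : p₁.IsHomogeneous n₁) (h₂ : p₂.IsHomogeneous n₂)
    (h₃ : p₃.IsHomogeneous n₃) (hp₁ : p₁ ≠ 0) (hp₂ : p₂ ≠ 0) (hp₃ : p₃ ≠ 0) :
    ∃ c : k, MvPolynomial.eval ![1, c] p₁ ≠ 0 ∧ MvPolynomial.eval ![1, c] p₂ ≠ 0 ∧
      MvPolynomial.eval ![1, c] p₃ ≠ 0 := by
  obtain ⟨x, hx⟩ : ∃ x, MvPolynomial.eval x (MvPolynomial.X 0 * p₁ * p₂ * p₃) ≠ 0 := by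
    by_contra! hx
    have := MvPolynomial.funext (q := 0) fun x => by rw [hx, map_zero]
    simp_all
  simp only [map_mul, MvPolynomial.eval_X, mul_ne_zero_iff] at hx
  obtain ⟨⟨⟨hx0, hx1⟩, hx2⟩, hx3⟩ := hx
  have key : x = fun i => x 0 * (![1, x 1 / x 0] : Fin 2 → k) i := by
    funext i
    fin_cases i
    · simp
    · simp [mul_div_cancel₀ _ hx0]
  rw [key, h₁.eval_mul_left] at hx1
  rw [key, h₂.eval_mul_left] at hx2
  rw [key, h₃.eval_mul_left] at hx3
  exact ⟨_, right_ne_zero_of_mul hx1, right_ne_zero_of_mul hx2, right_ne_zero_of_mul hx3⟩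

lemma AlgEquiv.finrank_quotient_span_pair {k A B : Type*} [Field k] [CommRing A] [CommRing B]
    [Algebra k A] [Algebra k B] (φ : A ≃ₐ[k] B) (a b : A) :
    Module.finrank k (A ⧸ Ideal.span {a, b}) = Module.finrank k (B ⧸ Ideal.span {φ a, φ b}) := by
  refine (Ideal.quotientEquivAlg _ _ φ ?_).toLinearEquiv.finrank_eq
  rw [Ideal.map_span, Set.image_pair]
  rfl

lemma MvPowerSeries.exists_isWeierstrassPolynomial {f : R}
    {φ : R ≃ₐ[ℂ] PowerSeries (PowerSeries ℂ)}
    (h : ((φ f).map (IsLocalRing.residue (PowerSeries ℂ))).order = (mult f : ℕ)) :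
    ∃ P, IsWeierstrassPolynomial (φ f) P ∧ P.natDegree = mult f := by
  obtain ⟨P, hP, hdeg⟩ := _root_.exists_isWeierstrassPolynomial (F := φ f) fun h0 => by
    rw [h0, PowerSeries.order_zero] at h
    exact ENat.top_ne_natCast _ h
  exact ⟨P, hP, by rw [hdeg, h, ENat.toNat_natCast]⟩

/-- Płoski's theorem. -/
theorem stmt0 (f g h : R)
    (hf : Irreducible f) (hg : Irreducible g) (hh : Irreducible h)
    (hfm : f ∈ IsLocalRing.maximalIdeal R)
    (hgm : g ∈ IsLocalRing.maximalIdeal R)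
    (hhm : h ∈ IsLocalRing.maximalIdeal R)
    (hfg : ¬ Associated f g) (hgh : ¬ Associated g h) (hhf : ¬ Associated h f)
    (Hfg : FiniteDimensional ℂ (R ⧸ Ideal.span {f, g}))
    (Hgh : FiniteDimensional ℂ (R ⧸ Ideal.span {g, h}))
    (Hhf : FiniteDimensional ℂ (R ⧸ Ideal.span {h, f})) :
    (((interNum g h : ℝ) / (mult g * mult h) = (interNum h f : ℝ) / (mult h * mult f)) ∧
        (interNum g h : ℝ) / (mult g * mult h) ≤ (interNum f g : ℝ) / (mult f * mult g)) ∨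
    (((interNum h f : ℝ) / (mult h * mult f) = (interNum f g : ℝ) / (mult f * mult g)) ∧
        (interNum h f : ℝ) / (mult h * mult f) ≤ (interNum g h : ℝ) / (mult g * mult h)) ∨
    (((interNum f g : ℝ) / (mult f * mult g) = (interNum g h : ℝ) / (mult g * mult h)) ∧
        (interNum f g : ℝ) / (mult f * mult g) ≤ (interNum h f : ℝ) / (mult h * mult f)) := by
  obtain ⟨p₁, hp₁, hhom₁, hord₁⟩ := MvPowerSeries.exists_initialForm hf.ne_zero
  obtain ⟨p₂, hp₂, hhom₂, hord₂⟩ := MvPowerSeries.exists_initialForm hg.ne_zero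
  obtain ⟨p₃, hp₃, hhom₃, hord₃⟩ := MvPowerSeries.exists_initialForm hh.ne_zero
  obtain ⟨c, hc₁, hc₂, hc₃⟩ :=
    MvPolynomial.exists_eval_one_ne_zero hhom₁ hhom₂ hhom₃ hp₁ hp₂ hp₃
  obtain ⟨φ, hφ0, hφ1⟩ := MvPowerSeries.exists_equiv_powerSeries c
  obtain ⟨P, hP, hPf⟩ := MvPowerSeries.exists_isWeierstrassPolynomial (hord₁ c φ hφ0 hφ1 hc₁)
  obtain ⟨Q, hQ, hQg⟩ := MvPowerSeries.exists_isWeierstrassPolynomial (hord₂ c φ hφ0 hφ1 hc₂)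
  obtain ⟨T, hT, hTh⟩ := MvPowerSeries.exists_isWeierstrassPolynomial (hord₃ c φ hφ0 hφ1 hc₃)
  have hprime : ∀ {a : R}, Irreducible a → Prime (φ a) := fun ha =>
    ((MulEquiv.irreducible_iff φ).2 ha).prime
  have hassoc : ∀ {a b : R}, ¬ Associated a b → ¬ Associated (φ a) (φ b) := fun hab h =>
    hab (by simpa using h.map φ.symm)
  exact trichotomy_finrank_quotient (hprime hf) (hprime hg) (hprime hh) (hassoc hfg) (hassoc hgh)
    (hassoc hhf) hP hQ hT
    (by rw [hQg, hTh, ← φ.finrank_quotient_span_pair, interNum])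
    (by rw [hTh, hPf, ← φ.finrank_quotient_span_pair, interNum])
    (by rw [hPf, hQg, ← φ.finrank_quotient_span_pair, interNum])
end

section
/- Let l, f, g, h be four irreducible elements of the maximal ideal 𝔪 of R = ℂ⟦x,y⟧, pairwise non-associated, with m(l) = 1 (l defines a smooth branch), and assume that each of the six quotient rings R modulo the ideal generated by a pair of these elements is a finite-dimensional ℂ-vector space. Then, in ℕ: I(f,g)·I(l,h) ≥ min( I(f,h)·I(l,g), I(g,h)·I(l,f) ). (Equivalently, the function u_l(A,B) = I(l,A)·I(l,B)/I(A,B) satisfies the ultrametric inequality u_l(f,g) ≤ max(u_l(f,h), u_l(g,h)).) -/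
local notation "R" => MvPowerSeries (Fin 2) ℂ

open Polynomial

theorem map_aroots_algEquiv {K L : Type*} [Field K] [Field L] [Algebra K L]
    {F : K[X]} (hF : (F.map (algebraMap K L)).Splits) (σ : L ≃ₐ[K] L) :
    (F.aroots L).map σ = F.aroots L := by
  have := hF.roots_map (σ : L →+* L)
  rw [Polynomial.map_map] at this
  have h2 : ((σ : L →+* L).comp (algebraMap K L)) = algebraMap K L := by ext; simp
  rw [h2] at this
  exact this.symm

theorem exists_algEquiv_of_mem_aroots_s2 {K L : Type*} [Field K] [Field L] [Algebra K L] [Normal K L]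
    {F : K[X]} (hF : Irreducible F) {a b : L}
    (ha : a ∈ F.aroots L) (hb : b ∈ F.aroots L) : ∃ σ : L ≃ₐ[K] L, σ a = b := by
  rw [mem_aroots] at ha hb
  have h : minpoly K a = minpoly K b := by
    rw [← minpoly.eq_of_irreducible hF ha.2, ← minpoly.eq_of_irreducible hF hb.2]
  exact (isConjRoot_iff_exists_algEquiv.1 h.symm)

/-- The product of `v (a - σ b)` over all automorphisms `σ`. -/
noncomputable def conjProd {K L : Type*} [Field K] [Field L] [Algebra K L] [FiniteDimensional K L]
    (v : AbsoluteValue L ℝ) (a b : L) : ℝ :=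
  ∏ σ : L ≃ₐ[K] L, v (a - σ b)

section
variable {K L : Type*} [Field K] [Field L] [Algebra K L] [FiniteDimensional K L]
  {v : AbsoluteValue L ℝ}

theorem conjProd_apply_right (τ : L ≃ₐ[K] L) (a b : L) :
    conjProd (K := K) v a (τ b) = conjProd (K := K) v a b :=
  Fintype.prod_equiv (Equiv.mulRight τ) _ _ fun _ ↦ rfl

theorem conjProd_comm (hv : ∀ (σ : L ≃ₐ[K] L) x, v (σ x) = v x) (a b : L) :
    conjProd (K := K) v a b = conjProd (K := K) v b a := by
  refine Fintype.prod_equiv (Equiv.inv _) _ _ fun σ ↦ ?_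
  have h : σ ((Equiv.inv _ σ) a) = a := σ.apply_symm_apply a
  rw [v.map_sub, ← hv σ (b - (Equiv.inv _ σ) a), map_sub σ, h]

theorem conjProd_apply_left (hv : ∀ (σ : L ≃ₐ[K] L) x, v (σ x) = v x) (τ : L ≃ₐ[K] L) (a b : L) :
    conjProd (K := K) v (τ a) b = conjProd (K := K) v a b := by
  rw [conjProd_comm hv, conjProd_apply_right, conjProd_comm hv]

theorem absoluteValue_resultant_pow_card [Normal K L] (hv : ∀ (σ : L ≃ₐ[K] L) x, v (σ x) = v x)
    {F G : K[X]} (hF : Irreducible F) (hG : Irreducible G) (mF : F.Monic) (mG : G.Monic)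
    (sF : (F.map (algebraMap K L)).Splits) (sG : (G.map (algebraMap K L)).Splits)
    {a b : L} (ha : a ∈ F.aroots L) (hb : b ∈ G.aroots L) :
    v (algebraMap K L (resultant F G)) ^ Fintype.card (L ≃ₐ[K] L) =
      conjProd (K := K) v a b ^ (F.natDegree * G.natDegree) := by
  have h1 : v (algebraMap K L (resultant F G)) =
      ((F.aroots L ×ˢ G.aroots L).map fun p ↦ v (p.1 - p.2)).prod := by
    have := resultant_eq_prod_roots_sub (F.map (algebraMap K L)) (G.map (algebraMap K L))
      (mF.map _) (mG.map _) sF sG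
    rw [natDegree_map, natDegree_map, resultant_map_map] at this
    rw [this, map_multiset_prod, Multiset.map_map]
    rfl
  have h2 (σ : L ≃ₐ[K] L) : v (algebraMap K L (resultant F G)) =
      ((F.aroots L ×ˢ G.aroots L).map fun p ↦ v (p.1 - σ p.2)).prod := by
    conv_lhs => rw [h1, ← map_aroots_algEquiv sG σ]
    have : F.aroots L ×ˢ (G.aroots L).map σ =
        (F.aroots L ×ˢ G.aroots L).map (Prod.map id σ) := by
      simp [SProd.sprod, Multiset.product, Multiset.map_bind, Multiset.map_map]
    rw [this, Multiset.map_map]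
    rfl
  have h3 : v (algebraMap K L (resultant F G)) ^ Fintype.card (L ≃ₐ[K] L) =
      ∏ σ : L ≃ₐ[K] L, ((F.aroots L ×ˢ G.aroots L).map fun p ↦ v (p.1 - σ p.2)).prod := by
    rw [Finset.prod_congr rfl fun σ _ ↦ (h2 σ).symm]
    simp
  have h4 : ∏ σ : L ≃ₐ[K] L, ((F.aroots L ×ˢ G.aroots L).map fun p ↦ v (p.1 - σ p.2)).prod =
      ((F.aroots L ×ˢ G.aroots L).map fun p ↦ conjProd (K := K) v p.1 p.2).prod :=
    (Multiset.prod_map_prod (m := F.aroots L ×ˢ G.aroots L)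
      (f := fun p (σ : L ≃ₐ[K] L) ↦ v (p.1 - σ p.2)) (s := Finset.univ)).symm
  have h5 : (F.aroots L ×ˢ G.aroots L).map (fun p ↦ conjProd (K := K) v p.1 p.2) =
      (F.aroots L ×ˢ G.aroots L).map (fun _ ↦ conjProd (K := K) v a b) := by
    refine Multiset.map_congr rfl fun p hp ↦ ?_
    rw [Multiset.mem_product] at hp
    obtain ⟨σ, hσ⟩ := exists_algEquiv_of_mem_aroots_s2 hF ha hp.1
    obtain ⟨τ, hτ⟩ := exists_algEquiv_of_mem_aroots_s2 hG hb hp.2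
    rw [← hσ, ← hτ, conjProd_apply_left hv, conjProd_apply_right]
  rw [h3, h4, h5, Multiset.map_const', Multiset.prod_replicate, Multiset.card_product,
    ← natDegree_map (f := algebraMap K L) (p := F), ← natDegree_map (f := algebraMap K L) (p := G),
    sF.natDegree_eq_card_roots, sG.natDegree_eq_card_roots]

theorem conjProd_le (hv : ∀ (σ : L ≃ₐ[K] L) x, v (σ x) = v x) (hna : IsNonarchimedean v)
    {a b c : L} (ha : ∀ σ : L ≃ₐ[K] L, v (a - c) ≤ v (σ a - c)) (hbc : v (b - c) ≤ v (a - c)) :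
    conjProd (K := K) v a b ≤ conjProd (K := K) v a c := by
  refine Finset.prod_le_prod (fun _ _ ↦ v.nonneg _) fun σ _ ↦ ?_
  have h1 : v (a - c) ≤ v (a - σ c) := by
    refine (ha σ⁻¹).trans_eq ?_
    have h : σ (σ⁻¹ a) = a := σ.apply_symm_apply a
    rw [← hv σ, map_sub σ, h]
  have h2 : v (σ c - σ b) ≤ v (a - σ c) := by
    rw [← map_sub, hv, v.map_sub]
    exact hbc.trans h1
  calc v (a - σ b) = v ((a - σ c) + (σ c - σ b)) := by ring_nf
    _ ≤ max (v (a - σ c)) (v (σ c - σ b)) := hna _ _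
    _ ≤ _ := max_le le_rfl h2

/-- The ultrametric inequality for resultants of irreducible polynomials. -/
theorem absoluteValue_resultant_ultrametric [Normal K L]
    (hv : ∀ (σ : L ≃ₐ[K] L) x, v (σ x) = v x) (hna : IsNonarchimedean v)
    {F G H : K[X]} (hF : Irreducible F) (hG : Irreducible G) (hH : Irreducible H)
    (mF : F.Monic) (mG : G.Monic) (mH : H.Monic)
    (sF : (F.map (algebraMap K L)).Splits) (sG : (G.map (algebraMap K L)).Splits)
    (sH : (H.map (algebraMap K L)).Splits) :
    v (algebraMap K L (resultant F G)) ^ H.natDegree ≤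
        v (algebraMap K L (resultant F H)) ^ G.natDegree ∨
      v (algebraMap K L (resultant F G)) ^ H.natDegree ≤
        v (algebraMap K L (resultant G H)) ^ F.natDegree := by
  have key {P : K[X]} (hP : Irreducible P) (sP : (P.map (algebraMap K L)).Splits) (c : L) :
      ∃ a ∈ P.aroots L, ∀ σ : L ≃ₐ[K] L, v (a - c) ≤ v (σ a - c) := by
    obtain ⟨a, ha⟩ := sP.exists_eval_eq_zero (by
      rw [degree_map]; exact (degree_pos_of_irreducible hP).ne')
    obtain ⟨τ, hτ⟩ := Finite.exists_min fun σ : L ≃ₐ[K] L ↦ v (σ a - c)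
    refine ⟨τ a, ?_, fun σ ↦ hτ (σ * τ)⟩
    rw [mem_aroots]
    refine ⟨hP.ne_zero, ?_⟩
    rw [aeval_algHom_apply, aeval_def, ← eval_map, ha, map_zero]
  obtain ⟨c, hc, -⟩ := key hH sH 0
  obtain ⟨a, ha, ha'⟩ := key hF sF c
  obtain ⟨b, hb, hb'⟩ := key hG sG c
  have hcard : Fintype.card (L ≃ₐ[K] L) ≠ 0 := Fintype.card_ne_zero
  have hFG := absoluteValue_resultant_pow_card hv hF hG mF mG sF sG ha hb
  have hFH := absoluteValue_resultant_pow_card hv hF hH mF mH sF sH ha hc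
  have hGH := absoluteValue_resultant_pow_card hv hG hH mG mH sG sH hb hc
  have hnn (x y : L) : 0 ≤ conjProd (K := K) v x y := Finset.prod_nonneg fun _ _ ↦ v.nonneg _
  rcases le_total (v (b - c)) (v (a - c)) with hbc | hbc
  · left
    rw [← pow_le_pow_iff_left₀ (pow_nonneg (v.nonneg _) _) (pow_nonneg (v.nonneg _) _) hcard,
      pow_right_comm, hFG, pow_right_comm (v (algebraMap K L (resultant F H))), hFH,
      ← pow_mul, ← pow_mul, mul_right_comm]
    exact pow_le_pow_left₀ (hnn _ _) (conjProd_le hv hna ha' hbc) _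
  · right
    rw [← pow_le_pow_iff_left₀ (pow_nonneg (v.nonneg _) _) (pow_nonneg (v.nonneg _) _) hcard,
      pow_right_comm, hFG, pow_right_comm (v (algebraMap K L (resultant G H))), hGH,
      ← pow_mul, ← pow_mul, mul_assoc, mul_comm F.natDegree, conjProd_comm hv]
    exact pow_le_pow_left₀ (hnn _ _) (conjProd_le hv hna hb' hbc) _
end

theorem AdjoinRoot.leftMulMatrix_powerBasisAux'_apply {A : Type*} [CommRing A] {F : A[X]}
    (hF : F.Monic) (G : A[X]) (i j : Fin F.natDegree) :
    Algebra.leftMulMatrix (AdjoinRoot.powerBasisAux' hF) (AdjoinRoot.mk F G) i j =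
      ((G * X ^ (j : ℕ)) %ₘ F).coeff i := by
  have h : AdjoinRoot.powerBasisAux' hF j = AdjoinRoot.mk F (X ^ (j : ℕ)) := by
    have := (AdjoinRoot.powerBasis' hF).basis_eq_pow j
    rw [AdjoinRoot.powerBasis'_gen, ← AdjoinRoot.mk_X, ← map_pow] at this
    exact this
  rw [Algebra.leftMulMatrix_eq_repr_mul, h, ← map_mul]
  exact AdjoinRoot.powerBasisAux'_repr_apply_to_fun hF _ i

theorem AdjoinRoot.norm_mk_map {A B : Type*} [CommRing A] [CommRing B] [Nontrivial B]
    (φ : A →+* B) {F : A[X]} (hF : F.Monic) (G : A[X]) :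
    Algebra.norm B (AdjoinRoot.mk (F.map φ) (G.map φ)) =
      φ (Algebra.norm A (AdjoinRoot.mk F G)) := by
  rw [Algebra.norm_eq_matrix_det (AdjoinRoot.powerBasisAux' hF),
    Algebra.norm_eq_matrix_det (AdjoinRoot.powerBasisAux' (hF.map φ)), RingHom.map_det,
    ← Matrix.det_reindex_self (finCongr (hF.natDegree_map φ))]
  congr 1
  ext i j
  rw [RingHom.mapMatrix_apply, Matrix.map_apply, Matrix.reindex_apply, Matrix.submatrix_apply,
    AdjoinRoot.leftMulMatrix_powerBasisAux'_apply, AdjoinRoot.leftMulMatrix_powerBasisAux'_apply,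
    ← coeff_map, map_modByMonic _ hF]
  simp

theorem AdjoinRoot.norm_mk_eq_resultant {K : Type*} [Field K] [CharZero K] {F : K[X]}
    (hF : Irreducible F) (mF : F.Monic) (G : K[X]) :
    Algebra.norm K (AdjoinRoot.mk F G) = resultant F G := by
  have := Fact.mk hF
  have : FiniteDimensional K (AdjoinRoot F) := mF.finite_adjoinRoot
  apply (algebraMap K (AlgebraicClosure K)).injective
  rw [Algebra.norm_eq_prod_embeddings]
  have h := resultant_eq_prod_eval (F.map (algebraMap K (AlgebraicClosure K)))
    (G.map (algebraMap K (AlgebraicClosure K))) G.natDegree (by simp) (IsAlgClosed.splits _)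
  rw [natDegree_map, resultant_map_map] at h
  rw [h, (mF.map _).leadingCoeff, one_pow, one_mul]
  have hn : (F.aroots (AlgebraicClosure K)).Nodup := nodup_roots hF.separable.map
  classical
  rw [Fintype.prod_equiv (AdjoinRoot.equiv (AlgebraicClosure K) K F hF.ne_zero)
    (fun σ ↦ σ (mk F G)) (fun x ↦ aeval (x : AlgebraicClosure K) G)]
  · have := Finset.prod_mem_multiset (F.aroots (AlgebraicClosure K))
      (fun x ↦ aeval (x : AlgebraicClosure K) G) (fun x ↦ aeval x G) (fun _ ↦ rfl)
    rw [this, Finset.prod_eq_multiset_prod, Multiset.toFinset_val, hn.dedup]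
    simp [aeval_def, eval_map]
  · intro σ
    have : ((AdjoinRoot.equiv (AlgebraicClosure K) K F hF.ne_zero σ) : AlgebraicClosure K) =
      σ (root F) := by
      simp [AdjoinRoot.equiv]
    rw [this, aeval_algHom_apply, AdjoinRoot.aeval_eq]

/-- The norm of an element of `A[X]/(F)` is a resultant. -/
theorem AdjoinRoot.norm_mk_eq_resultant' {A : Type*} [CommRing A] [IsDomain A] [CharZero A]
    [IsIntegrallyClosed A] {F : A[X]} (hF : Irreducible F) (mF : F.Monic) (G : A[X]) :
    Algebra.norm A (AdjoinRoot.mk F G) = resultant F G := by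
  apply FaithfulSMul.algebraMap_injective A (FractionRing A)
  have := charZero_of_injective_algebraMap (FaithfulSMul.algebraMap_injective A (FractionRing A))
  rw [← AdjoinRoot.norm_mk_map _ mF, AdjoinRoot.norm_mk_eq_resultant
    ((mF.irreducible_iff_irreducible_map_fraction_map (K := FractionRing A)).1 hF) (mF.map _),
    mF.natDegree_map, natDegree_map_eq_of_injective, resultant_map_map]
  exact FaithfulSMul.algebraMap_injective A (FractionRing A)

/-- The first `n` coefficients identify `k⟦X⟧ / (X ^ n)` with `k ^ n`. -/
noncomputable def PowerSeries.quotientXPowEquiv (k : Type*) [Field k] (n : ℕ) :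
    (PowerSeries k ⧸ Ideal.span {(PowerSeries.X : PowerSeries k) ^ n}) ≃ₗ[k] (Fin n → k) :=
  let φ : PowerSeries k →ₗ[k] (Fin n → k) := LinearMap.pi fun i ↦ PowerSeries.coeff (i : ℕ)
  (Submodule.Quotient.restrictScalarsEquiv k
      (Ideal.span {(PowerSeries.X : PowerSeries k) ^ n})).symm.trans
    ((Submodule.quotEquivOfEq _ φ.ker (by
        ext f
        rw [Submodule.restrictScalars_mem, Ideal.mem_span_singleton, PowerSeries.X_pow_dvd_iff,
          LinearMap.mem_ker, funext_iff]
        exact ⟨fun h i ↦ h i i.2, fun h i hi ↦ h ⟨i, hi⟩⟩)).trans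
      (φ.quotKerEquivOfSurjective fun f ↦
        ⟨PowerSeries.mk fun i ↦ if h : i < n then f ⟨i, h⟩ else 0, by ext i; simp [φ]⟩))

theorem PowerSeries.finite_quotient_span_and_associated {k : Type*} [Field k] {a : PowerSeries k}
    (ha : a ≠ 0) : Module.Finite k (PowerSeries k ⧸ Ideal.span {a}) ∧
      Associated a (PowerSeries.X ^ Module.finrank k (PowerSeries k ⧸ Ideal.span {a})) := by
  obtain ⟨n, hn⟩ := IsDiscreteValuationRing.associated_pow_irreducible ha
    (PowerSeries.X_irreducible : Irreducible (PowerSeries.X : PowerSeries k))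
  rw [Ideal.span_singleton_eq_span_singleton.2 hn]
  refine ⟨.equiv (PowerSeries.quotientXPowEquiv k n).symm, ?_⟩
  rwa [(PowerSeries.quotientXPowEquiv k n).finrank_eq, Module.finrank_fin_fun]

theorem PowerSeries.associated_norm_X_pow_finrank {k D ι : Type*} [Field k] [CommRing D]
    [IsDomain D] [Algebra (PowerSeries k) D] [Algebra k D] [IsScalarTower k (PowerSeries k) D]
    [Finite ι] (b : Module.Basis ι (PowerSeries k) D) {f : D} (hf : f ≠ 0) :
    Associated (Algebra.norm (PowerSeries k) f)
      (PowerSeries.X ^ Module.finrank k (D ⧸ Ideal.span {f})) := by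
  have := Fintype.ofFinite ι
  have h := Ideal.span_singleton_eq_bot.not.2 hf
  have hfin (i : ι) : Module.Finite k
      (PowerSeries k ⧸ Ideal.span {Ideal.smithCoeffs b _ h i}) :=
    (PowerSeries.finite_quotient_span_and_associated (Ideal.smithCoeffs_ne_zero b _ h i)).1
  refine (associated_norm_prod_smith b hf).trans ?_
  rw [Ideal.finrank_quotient_eq_sum k h b, ← Finset.prod_pow_eq_pow_sum]
  exact Associated.prod _ _ _ fun i _ ↦
    (PowerSeries.finite_quotient_span_and_associated (Ideal.smithCoeffs_ne_zero b _ h i)).2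

theorem Polynomial.IsDistinguishedAt.irreducible_of_irreducible_coe {A : Type*} [CommRing A]
    [IsDomain A] [IsLocalRing A] {F : A[X]}
    (dF : F.IsDistinguishedAt (IsLocalRing.maximalIdeal A))
    (hF : Irreducible (F : PowerSeries A)) : Irreducible F := by
  have key {P Q : A[X]} (mP : P.Monic) (h : P * Q = F) (hP : IsUnit (P : PowerSeries A)) :
      P.natDegree = 0 := by
    rw [PowerSeries.isUnit_iff_constantCoeff, Polynomial.constantCoeff_coe] at hP
    have hX := dF.map_eq_X_pow
    rw [← h, Polynomial.map_mul] at hX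
    obtain ⟨i, -, hi⟩ := (dvd_prime_pow Polynomial.prime_X _).1 ⟨_, hX.symm⟩
    have hi := eq_of_monic_of_associated (mP.map _) (monic_X_pow i) hi
    have hd : P.natDegree = i := by
      rw [← mP.natDegree_map (Ideal.Quotient.mk (IsLocalRing.maximalIdeal A)), hi,
        natDegree_X_pow]
    by_contra h0
    have h1 : (P.map (Ideal.Quotient.mk (IsLocalRing.maximalIdeal A))).coeff 0 = 0 := by
      rw [hi, coeff_X_pow, if_neg (by omega)]
    rw [coeff_map, Ideal.Quotient.eq_zero_iff_mem] at h1
    exact h1 hP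
  refine dF.monic.irreducible_iff_natDegree.2 ⟨fun h ↦ hF.not_isUnit (by simp [h]),
    fun P Q mP mQ h ↦ ?_⟩
  have := hF.isUnit_or_isUnit (a := (P : PowerSeries A)) (b := (Q : PowerSeries A))
    (by rw [← h, Polynomial.coe_mul])
  exact this.imp (key mP h) (key mQ (mul_comm P Q ▸ h))

/-- Cutting the plane by a distinguished polynomial `F` and by `g` is the same as
cutting `A[Y]/(F)` by the image of `g`. -/
noncomputable def Polynomial.IsDistinguishedAt.quotientSpanPairEquiv (k : Type*) {A : Type*}
    [CommRing k] [CommRing A] [IsLocalRing A] [IsAdicComplete (IsLocalRing.maximalIdeal A) A]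
    [Algebra k A] {F : A[X]}
    (dF : F.IsDistinguishedAt (IsLocalRing.maximalIdeal A)) (G : A[X]) :
    (PowerSeries A ⧸ Ideal.span {(F : PowerSeries A), (G : PowerSeries A)}) ≃ₐ[k]
      AdjoinRoot F ⧸ Ideal.span {AdjoinRoot.mk F G} :=
  (Ideal.quotientEquivAlgOfEq k (Ideal.span_insert _ _)).trans <|
    (DoubleQuot.quotQuotEquivQuotSupₐ k _ _).symm.trans <|
    (Ideal.quotientEquivAlg (Ideal.span {Ideal.Quotient.mk (Ideal.span {F}) G}) _
      (dF.algEquivQuotient.restrictScalars k) (by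
        rw [Ideal.map_span, Ideal.map_span, Set.image_singleton, Set.image_singleton]
        rfl)).symm

instance PowerSeries.isAdicComplete_maximalIdeal_s2 {k : Type*} [Field k] :
    IsAdicComplete (IsLocalRing.maximalIdeal (PowerSeries k)) (PowerSeries k) := by
  rw [PowerSeries.maximalIdeal_eq_span_X]
  infer_instance

section
variable {k : Type*} [Field k]

theorem Polynomial.IsDistinguishedAt.associated_resultant_X_pow_finrank [CharZero k]
    {F G : (PowerSeries k)[X]}
    (dF : F.IsDistinguishedAt (IsLocalRing.maximalIdeal (PowerSeries k)))
    (hF : Irreducible (F : PowerSeries (PowerSeries k)))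
    (hG : Irreducible (G : PowerSeries (PowerSeries k)))
    (hFG : ¬ Associated (F : PowerSeries (PowerSeries k)) G) :
    Associated (resultant F G) (PowerSeries.X ^ Module.finrank k
      (PowerSeries (PowerSeries k) ⧸ Ideal.span {(F : PowerSeries (PowerSeries k)),
        (G : PowerSeries (PowerSeries k))})) := by
  have hF' := dF.irreducible_of_irreducible_coe hF
  have := AdjoinRoot.isDomain_of_prime hF'.prime
  have h0 : AdjoinRoot.mk F G ≠ 0 := by
    rw [Ne, AdjoinRoot.mk_eq_zero]
    rintro ⟨Q, rfl⟩
    rw [Polynomial.coe_mul] at hG hFG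
    have := (hG.isUnit_or_isUnit rfl).resolve_left hF.not_isUnit
    exact hFG (associated_mul_unit_right _ _ this)
  have : CharZero (PowerSeries k) := charZero_of_injective_algebraMap
    (FaithfulSMul.algebraMap_injective k (PowerSeries k))
  rw [← AdjoinRoot.norm_mk_eq_resultant' hF' dF.monic,
    (dF.quotientSpanPairEquiv k G).toLinearEquiv.finrank_eq]
  exact PowerSeries.associated_norm_X_pow_finrank (AdjoinRoot.powerBasisAux' dF.monic) h0

theorem Polynomial.IsDistinguishedAt.finrank_quotient_span_C_X {F : (PowerSeries k)[X]}
    (dF : F.IsDistinguishedAt (IsLocalRing.maximalIdeal (PowerSeries k)))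
    (hF : Irreducible (F : PowerSeries (PowerSeries k))) :
    Module.finrank k (PowerSeries (PowerSeries k) ⧸ Ideal.span
      {PowerSeries.C (PowerSeries.X : PowerSeries k), (F : PowerSeries (PowerSeries k))}) =
      F.natDegree := by
  have hF' := dF.irreducible_of_irreducible_coe hF
  have := AdjoinRoot.isDomain_of_prime hF'.prime
  have h := (dF.quotientSpanPairEquiv k (C PowerSeries.X)).toLinearEquiv.finrank_eq
  have := dF.monic.free_adjoinRoot
  rw [Set.pair_comm, ← Polynomial.coe_C, h]
  have : Module.Finite (PowerSeries k) (AdjoinRoot F) := dF.monic.finite_adjoinRoot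
  have h0 : AdjoinRoot.mk F (C PowerSeries.X) ≠ 0 := by
    rw [AdjoinRoot.mk_C, ← AdjoinRoot.algebraMap_eq, Ne, FaithfulSMul.algebraMap_eq_zero_iff]
    exact PowerSeries.X_ne_zero
  have h1 := PowerSeries.associated_norm_X_pow_finrank (AdjoinRoot.powerBasisAux' dF.monic) h0
  rw [AdjoinRoot.mk_C, ← AdjoinRoot.algebraMap_eq, Algebra.norm_algebraMap,
    (AdjoinRoot.powerBasis' dF.monic).finrank, AdjoinRoot.powerBasis'_dim] at h1
  have hu : ¬ IsUnit (PowerSeries.X : PowerSeries k) := PowerSeries.X_prime.not_isUnit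
  exact le_antisymm ((pow_dvd_pow_iff PowerSeries.X_ne_zero hu).1 h1.dvd')
    ((pow_dvd_pow_iff PowerSeries.X_ne_zero hu).1 h1.dvd)
end

section
open scoped Valued

theorem LaurentSeries.exists_absoluteValue (k L : Type*) [Field k] [Field L]
    [Algebra (LaurentSeries k) L] [FiniteDimensional (LaurentSeries k) L] :
    ∃ v : AbsoluteValue L ℝ, (∀ (σ : L ≃ₐ[LaurentSeries k] L) x, v (σ x) = v x) ∧
      IsNonarchimedean v ∧ ∃ r : ℝ, 0 < r ∧ r < 1 ∧ ∀ (a : PowerSeries k) (n : ℕ),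
        Associated a (PowerSeries.X ^ n) →
          v (algebraMap (LaurentSeries k) L (algebraMap (PowerSeries k) (LaurentSeries k) a)) =
            r ^ n := by
  have hv : Valued.v (algebraMap (PowerSeries k) (LaurentSeries k) PowerSeries.X) =
      WithZero.exp (-1 : ℤ) := by
    have := LaurentSeries.valuation_X_pow k 1
    simpa using this
  have : (Valued.v : Valuation (LaurentSeries k) (WithZero (Multiplicative ℤ))).IsRankOneDiscrete :=
    Valuation.IsRankOneDiscrete.mk' ((PowerSeries.idealX k).valuation (LaurentSeries k))
  let : (Valued.v : Valuation (LaurentSeries k) (WithZero (Multiplicative ℤ))).RankOne :=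
    Valuation.IsRankOneDiscrete.rankOne _ (e := 2) (by norm_num)
  let := Valued.toNontriviallyNormedField (LaurentSeries k) (WithZero (Multiplicative ℤ))
  have hle (a : PowerSeries k) : ‖algebraMap (PowerSeries k) (LaurentSeries k) a‖ ≤ 1 := by
    rw [Valued.toNormedField.norm_le_one_iff, LaurentSeries.val_le_one_iff_eq_coe]
    exact ⟨a, rfl⟩
  have hunit (u : (PowerSeries k)ˣ) : ‖algebraMap (PowerSeries k) (LaurentSeries k) u‖ = 1 := by
    refine (hle _).antisymm ?_
    have h1 := norm_mul (algebraMap (PowerSeries k) (LaurentSeries k) u)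
      (algebraMap (PowerSeries k) (LaurentSeries k) (u⁻¹ : (PowerSeries k)ˣ))
    rw [← map_mul, Units.mul_inv, map_one, norm_one] at h1
    rw [h1]
    exact mul_le_of_le_one_right (norm_nonneg _) (hle _)
  let v : AbsoluteValue L ℝ :=
    { toFun := spectralNorm (LaurentSeries k) L
      map_mul' := (spectralMulAlgNorm (LaurentSeries k) L).map_mul'
      nonneg' := spectralNorm_nonneg
      eq_zero' := fun x ↦ ⟨(spectralMulAlgNorm (LaurentSeries k) L).eq_zero_of_map_eq_zero' x,
        fun h ↦ by rw [h]; exact spectralNorm_zero⟩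
      add_le' := fun x y ↦
        (isNonarchimedean_spectralNorm (K := LaurentSeries k)).add_le spectralNorm_nonneg }
  refine ⟨v, fun σ x ↦ (spectralNorm_eq_of_equiv σ x).symm, isNonarchimedean_spectralNorm,
    ‖algebraMap (PowerSeries k) (LaurentSeries k) PowerSeries.X‖, ?_, ?_, fun a n h ↦ ?_⟩
  · rw [norm_pos_iff, Ne, FaithfulSMul.algebraMap_eq_zero_iff]
    exact PowerSeries.X_ne_zero
  · rw [Valued.toNormedField.norm_lt_one_iff, hv]
    decide
  · obtain ⟨u, hu⟩ := h.symm
    have h1 : v _ = _ := spectralNorm_extends (L := L)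
      (algebraMap (PowerSeries k) (LaurentSeries k) a)
    rw [h1, ← hu, map_mul, norm_mul, hunit, mul_one, map_pow, norm_pow]
end

/-- Weierstrass preparation for a prime of `k⟦X⟧⟦Y⟧` other than `X`. -/
theorem PowerSeries.exists_isDistinguishedAt_associated {k : Type*} [Field k]
    {f : PowerSeries (PowerSeries k)} (hf : Irreducible f)
    (hX : ¬ Associated (PowerSeries.C PowerSeries.X) f) :
    ∃ F : (PowerSeries k)[X], F.IsDistinguishedAt (IsLocalRing.maximalIdeal (PowerSeries k)) ∧
      Associated f F := by
  have hres : f.map (IsLocalRing.residue (PowerSeries k)) ≠ 0 := by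
    intro h0
    refine hX ?_
    have hX : ¬ IsUnit (PowerSeries.C (PowerSeries.X : PowerSeries k)) := by
      rw [PowerSeries.isUnit_iff_constantCoeff, PowerSeries.constantCoeff_C]
      exact (PowerSeries.X_irreducible : Irreducible (PowerSeries.X : PowerSeries k)).not_isUnit
    have hdvd (n : ℕ) : PowerSeries.X ∣ PowerSeries.coeff n f := by
      rw [← Ideal.mem_span_singleton, ← PowerSeries.maximalIdeal_eq_span_X,
        ← IsLocalRing.residue_eq_zero_iff, ← PowerSeries.coeff_map, h0, map_zero]
    choose c hc using hdvd
    have : f = PowerSeries.C PowerSeries.X * PowerSeries.mk c := by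
      ext1 n
      rw [PowerSeries.coeff_C_mul, PowerSeries.coeff_mk, hc]
    obtain h | h := hf.isUnit_or_isUnit this
    · exact absurd h hX
    · exact ⟨h.unit, this.symm⟩
  obtain ⟨F, u, h⟩ := PowerSeries.exists_isWeierstrassFactorization hres
  exact ⟨F, h.isDistinguishedAt, by
    rw [h.eq_mul]; exact (associated_mul_unit_left _ _ h.isUnit)⟩

theorem Ideal.span_pair_eq_of_associated {A : Type*} [CommRing A] [IsDomain A] {a b a' b' : A}
    (ha : Associated a a') (hb : Associated b b') : Ideal.span {a, b} = Ideal.span {a', b'} := by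
  rw [Ideal.span_insert, Ideal.span_insert, Ideal.span_singleton_eq_span_singleton.2 ha,
    Ideal.span_singleton_eq_span_singleton.2 hb]

theorem Polynomial.IsDistinguishedAt.min_finrank_mul_natDegree_le {k : Type*} [Field k]
    [CharZero k] {F G H : (PowerSeries k)[X]}
    (dF : F.IsDistinguishedAt (IsLocalRing.maximalIdeal (PowerSeries k)))
    (dG : G.IsDistinguishedAt (IsLocalRing.maximalIdeal (PowerSeries k)))
    (dH : H.IsDistinguishedAt (IsLocalRing.maximalIdeal (PowerSeries k)))
    (hF : Irreducible (F : PowerSeries (PowerSeries k)))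
    (hG : Irreducible (G : PowerSeries (PowerSeries k)))
    (hH : Irreducible (H : PowerSeries (PowerSeries k)))
    (hFG : ¬ Associated (F : PowerSeries (PowerSeries k)) G)
    (hFH : ¬ Associated (F : PowerSeries (PowerSeries k)) H)
    (hGH : ¬ Associated (G : PowerSeries (PowerSeries k)) H) :
    min (Module.finrank k (PowerSeries (PowerSeries k) ⧸
          Ideal.span {(F : PowerSeries (PowerSeries k)), (H : PowerSeries (PowerSeries k))}) *
        G.natDegree)
      (Module.finrank k (PowerSeries (PowerSeries k) ⧸
          Ideal.span {(G : PowerSeries (PowerSeries k)), (H : PowerSeries (PowerSeries k))}) *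
        F.natDegree) ≤
      Module.finrank k (PowerSeries (PowerSeries k) ⧸
          Ideal.span {(F : PowerSeries (PowerSeries k)), (G : PowerSeries (PowerSeries k))}) *
        H.natDegree := by
  have rFG := dF.associated_resultant_X_pow_finrank hF hG hFG
  have rFH := dF.associated_resultant_X_pow_finrank hF hH hFH
  have rGH := dG.associated_resultant_X_pow_finrank hG hH hGH
  let K := LaurentSeries k
  let φ : PowerSeries k →+* K := algebraMap (PowerSeries k) K
  have irr {P : (PowerSeries k)[X]}
      (dP : P.IsDistinguishedAt (IsLocalRing.maximalIdeal (PowerSeries k)))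
      (hP : Irreducible (P : PowerSeries (PowerSeries k))) : Irreducible (P.map φ) :=
    (dP.monic.irreducible_iff_irreducible_map_fraction_map (K := K)).1
      (dP.irreducible_of_irreducible_coe hP)
  let T : K[X] := F.map φ * G.map φ * H.map φ
  have hT : T ≠ 0 := mul_ne_zero (mul_ne_zero (irr dF hF).ne_zero (irr dG hG).ne_zero)
    (irr dH hH).ne_zero
  let L := T.SplittingField
  have spl {P : K[X]} (h : P ∣ T) : (P.map (algebraMap K L)).Splits :=
    (SplittingField.splits T).of_dvd (Polynomial.map_ne_zero hT) (Polynomial.map_dvd _ h)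
  have : Normal K L := Normal.of_isSplittingField T
  obtain ⟨v, hσ, hna, r, hr0, hr1, hv⟩ := LaurentSeries.exists_absoluteValue k L
  have key := absoluteValue_resultant_ultrametric hσ hna (irr dF hF) (irr dG hG) (irr dH hH)
    (dF.monic.map φ) (dG.monic.map φ) (dH.monic.map φ)
    (spl (Dvd.intro _ (mul_assoc _ _ _).symm))
    (spl ((Dvd.intro_left _ rfl).mul_right _)) (spl (Dvd.intro_left _ rfl))
  have res {P Q : (PowerSeries k)[X]}
      (dP : P.IsDistinguishedAt (IsLocalRing.maximalIdeal (PowerSeries k)))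
      (dQ : Q.IsDistinguishedAt (IsLocalRing.maximalIdeal (PowerSeries k))) :
      resultant (P.map φ) (Q.map φ) = φ (resultant P Q) := by
    rw [dP.monic.natDegree_map, dQ.monic.natDegree_map, resultant_map_map]
  rw [res dF dG, res dF dH, res dG dH, hv _ _ rFG, hv _ _ rFH, hv _ _ rGH,
    dF.monic.natDegree_map, dG.monic.natDegree_map, dH.monic.natDegree_map, ← pow_mul, ← pow_mul,
    ← pow_mul, pow_le_pow_iff_right_of_lt_one₀ hr0 hr1,
    pow_le_pow_iff_right_of_lt_one₀ hr0 hr1] at key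
  exact min_le_iff.2 key

theorem PowerSeries.min_finrank_mul_finrank_le {k : Type*} [Field k] [CharZero k]
    {f g h : PowerSeries (PowerSeries k)} (hf : Irreducible f) (hg : Irreducible g)
    (hh : Irreducible h) (hfg : ¬ Associated f g) (hfh : ¬ Associated f h)
    (hgh : ¬ Associated g h) (hXf : ¬ Associated (PowerSeries.C PowerSeries.X) f)
    (hXg : ¬ Associated (PowerSeries.C PowerSeries.X) g)
    (hXh : ¬ Associated (PowerSeries.C PowerSeries.X) h) :
    min (Module.finrank k (PowerSeries (PowerSeries k) ⧸ Ideal.span {f, h}) *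
        Module.finrank k (PowerSeries (PowerSeries k) ⧸
          Ideal.span {PowerSeries.C PowerSeries.X, g}))
      (Module.finrank k (PowerSeries (PowerSeries k) ⧸ Ideal.span {g, h}) *
        Module.finrank k (PowerSeries (PowerSeries k) ⧸
          Ideal.span {PowerSeries.C PowerSeries.X, f})) ≤
      Module.finrank k (PowerSeries (PowerSeries k) ⧸ Ideal.span {f, g}) *
        Module.finrank k (PowerSeries (PowerSeries k) ⧸
          Ideal.span {PowerSeries.C PowerSeries.X, h}) := by
  obtain ⟨F, dF, aF⟩ := PowerSeries.exists_isDistinguishedAt_associated hf hXf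
  obtain ⟨G, dG, aG⟩ := PowerSeries.exists_isDistinguishedAt_associated hg hXg
  obtain ⟨H, dH, aH⟩ := PowerSeries.exists_isDistinguishedAt_associated hh hXh
  have hF := aF.irreducible hf
  have hG := aG.irreducible hg
  have hH := aH.irreducible hh
  rw [Ideal.span_pair_eq_of_associated aF aG, Ideal.span_pair_eq_of_associated aF aH,
    Ideal.span_pair_eq_of_associated aG aH,
    Ideal.span_pair_eq_of_associated (Associated.refl (PowerSeries.C PowerSeries.X)) aF,
    Ideal.span_pair_eq_of_associated (Associated.refl (PowerSeries.C PowerSeries.X)) aG,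
    Ideal.span_pair_eq_of_associated (Associated.refl (PowerSeries.C PowerSeries.X)) aH,
    dF.finrank_quotient_span_C_X hF, dG.finrank_quotient_span_C_X hG,
    dH.finrank_quotient_span_C_X hH]
  exact dF.min_finrank_mul_natDegree_le dG dH hF hG hH
    (fun e ↦ hfg (aF.trans (e.trans aG.symm))) (fun e ↦ hfh (aF.trans (e.trans aH.symm)))
    (fun e ↦ hgh (aG.trans (e.trans aH.symm)))

section shift
open MvPowerSeries

variable {k : Type*} [Field k]

/-- The images of the variables under the shift of the variable `none` by the power series `c`
in the variable `some ()`. -/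
noncomputable def MvPowerSeries.shiftVar (c : PowerSeries k) :
    Option Unit → MvPowerSeries (Option Unit) k
  | none => X none + rename some (c : MvPowerSeries Unit k)
  | some i => X (some i)

theorem MvPowerSeries.hasSubst_shiftVar {c : PowerSeries k} (hc : PowerSeries.constantCoeff c = 0) :
    HasSubst (shiftVar c) := by
  refine hasSubst_of_constantCoeff_zero fun s ↦ ?_
  cases s with
  | none =>
    rw [shiftVar, map_add, constantCoeff_X, zero_add, constantCoeff_rename]
    exact hc
  | some i => exact constantCoeff_X _

theorem MvPowerSeries.subst_shiftVar_rename {c : PowerSeries k}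
    (hc : PowerSeries.constantCoeff c = 0) (d : MvPowerSeries Unit k) :
    subst (shiftVar c) (rename (some : Unit → Option Unit) d) = rename some d := by
  rw [rename_eq_subst, subst_comp_subst_apply (HasSubst.X_comp _) (hasSubst_shiftVar hc)]
  congr 1
  ext1 s
  exact subst_X (hasSubst_shiftVar hc) (some s)

theorem MvPowerSeries.substAlgHom_shiftVar_comp_neg {c d : PowerSeries k}
    (hc : PowerSeries.constantCoeff c = 0) (hd : PowerSeries.constantCoeff d = 0)
    (hcd : c + d = 0) :
    (substAlgHom (hasSubst_shiftVar hc) :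
        MvPowerSeries (Option Unit) k →ₐ[k] MvPowerSeries (Option Unit) k).comp
      (substAlgHom (hasSubst_shiftVar hd)) =
      AlgHom.id k _ := by
  ext1 f
  rw [AlgHom.comp_apply, substAlgHom_apply, substAlgHom_apply,
    subst_comp_subst_apply (hasSubst_shiftVar hd) (hasSubst_shiftVar hc), AlgHom.id_apply]
  conv_rhs => rw [← id_eq f, ← subst_self]
  congr 1
  ext1 s
  cases s with
  | none =>
    rw [shiftVar, subst_add (hasSubst_shiftVar hc), subst_X (hasSubst_shiftVar hc),
      subst_shiftVar_rename hc, shiftVar, add_assoc, ← map_add, hcd, map_zero, add_zero]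
  | some i => exact subst_X (hasSubst_shiftVar hc) _

/-- The automorphism of `k⟦x, y⟧` shifting one variable by a power series in the other one. -/
noncomputable def MvPowerSeries.shiftEquiv (c : PowerSeries k)
    (hc : PowerSeries.constantCoeff c = 0) :
    MvPowerSeries (Option Unit) k ≃ₐ[k] MvPowerSeries (Option Unit) k :=
  have hc' : PowerSeries.constantCoeff (-c) = 0 := by rw [map_neg, hc, neg_zero]
  AlgEquiv.ofAlgHom (substAlgHom (hasSubst_shiftVar hc)) (substAlgHom (hasSubst_shiftVar hc'))
    (substAlgHom_shiftVar_comp_neg hc hc' (add_neg_cancel c))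
    (substAlgHom_shiftVar_comp_neg hc' hc (neg_add_cancel c))

theorem MvPowerSeries.shiftEquiv_X_sub_rename (c : PowerSeries k)
    (hc : PowerSeries.constantCoeff c = 0) :
    shiftEquiv c hc (X none - rename some (c : MvPowerSeries Unit k)) = X none := by
  have h := hasSubst_shiftVar hc
  change (substAlgHom h :
    MvPowerSeries (Option Unit) k →ₐ[k] MvPowerSeries (Option Unit) k) _ = _
  rw [map_sub, substAlgHom_apply, substAlgHom_apply, subst_X h, subst_shiftVar_rename hc, shiftVar,
    add_sub_cancel_right]

theorem MvPowerSeries.optionEquivLeft_rename_some {σ A : Type*} [CommRing A]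
    [Filter.TendstoCofinite (some : σ → Option σ)] (c : MvPowerSeries σ A) :
    optionEquivLeft σ A (rename some c) = PowerSeries.C c := by
  ext n x
  rw [coeff_coeff_optionEquivLeft, PowerSeries.coeff_C]
  split_ifs with hn
  · subst hn
    refine Eq.trans ?_ (coeff_embDomain_rename Function.Embedding.some c x)
    congr 2
    ext a
    cases a with
    | none =>
      rw [Finsupp.optionElim_apply_none, Finsupp.embDomain_of_notMem_range]
      simp
    | some a =>
      rw [Finsupp.optionElim_apply_some]
      exact (Finsupp.embDomain_apply_self Function.Embedding.some x a).symm
  · rw [map_zero]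
    refine coeff_rename_eq_zero _ _ ?_
    rintro ⟨y, hy⟩
    apply hn
    have := DFunLike.congr_fun hy none
    rw [Finsupp.optionElim_apply_none, Finsupp.mapDomain_of_notMem_range] at this
    · exact this.symm
    · simp

theorem MvPowerSeries.coeff_coeff_optionEquivLeft_rename {σ τ A : Type*} [CommRing A]
    (e : σ ≃ Option τ) (l : MvPowerSeries σ A) {n : ℕ} {x : τ →₀ ℕ} {y : σ →₀ ℕ}
    (h : Finsupp.optionElim n x = Finsupp.embDomain e.toEmbedding y) :
    coeff x (PowerSeries.coeff n (optionEquivLeft τ A (rename e l))) = coeff y l := by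
  rw [coeff_coeff_optionEquivLeft, h]
  exact coeff_embDomain_rename e.toEmbedding l _

/-- A power series with nonzero linear coefficient in the variable `i` is a coordinate. -/
theorem MvPowerSeries.exists_algEquiv_associated_C_X_of_coeff {l : MvPowerSeries (Fin 2) k}
    (h0 : constantCoeff l = 0) {i : Fin 2} (hi : coeff (Finsupp.single i 1) l ≠ 0) :
    ∃ e : MvPowerSeries (Fin 2) k ≃ₐ[k] PowerSeries (PowerSeries k),
      Associated (PowerSeries.C PowerSeries.X) (e l) := by
  let σ : Fin 2 ≃ Option Unit :=
    (finSuccEquiv' i).trans (Equiv.optionCongr (Equiv.ofUnique (Fin 1) Unit))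
  have hσ : σ i = none := by simp [σ]
  let l' : MvPowerSeries (Option Unit) k := rename σ l
  let ψ : MvPowerSeries (Option Unit) k ≃ₐ[k] PowerSeries (PowerSeries k) := optionEquivLeft Unit k
  have hl0 : PowerSeries.constantCoeff (PowerSeries.coeff 0 (ψ l')) = 0 := by
    refine (coeff_coeff_optionEquivLeft_rename σ l (y := 0) ?_).trans h0
    ext a; cases a <;> simp
  have hl1 : PowerSeries.constantCoeff (PowerSeries.coeff 1 (ψ l')) ≠ 0 := by
    refine fun h ↦ hi (Eq.trans (Eq.symm ?_) h)
    refine coeff_coeff_optionEquivLeft_rename σ l ?_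
    rw [Finsupp.embDomain_single]
    ext a; cases a <;> simp [hσ]
  have hres (a : PowerSeries k) :
      IsLocalRing.residue (PowerSeries k) a = 0 ↔ PowerSeries.constantCoeff a = 0 := by
    rw [IsLocalRing.residue_eq_zero_iff, PowerSeries.maximalIdeal_eq_span_X,
      Ideal.mem_span_singleton, PowerSeries.X_dvd_iff]
  have hord : ((ψ l').map (IsLocalRing.residue (PowerSeries k))).order = (1 : ℕ) := by
    rw [PowerSeries.order_eq_nat]
    refine ⟨?_, fun j hj ↦ ?_⟩
    · rwa [PowerSeries.coeff_map, Ne, hres]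
    · rw [Nat.lt_one_iff.1 hj, PowerSeries.coeff_map, hres]
      exact hl0
  obtain ⟨F, u, h⟩ := PowerSeries.exists_isWeierstrassFactorization
    (g := ψ l') (fun h ↦ hl1 ((hres _).1 (by
      rw [← PowerSeries.coeff_map, h, map_zero])))
  have hdeg : F.natDegree = 1 := by
    rw [h.natDegree_eq_toNat_order_map, hord]; rfl
  have hF := h.isDistinguishedAt.monic.eq_X_add_C hdeg
  have hF0 : PowerSeries.constantCoeff (F.coeff 0) = 0 := by
    rw [← hres, IsLocalRing.residue_eq_zero_iff]
    exact h.isDistinguishedAt.mem (by rw [hdeg]; norm_num)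
  have hc : PowerSeries.constantCoeff (-F.coeff 0) = 0 := by rw [map_neg, hF0, neg_zero]
  let c : PowerSeries k := -F.coeff 0
  have hass : Associated (X none - rename some (c : MvPowerSeries Unit k)) l' := by
    have h1 : ψ (X none - rename some (c : MvPowerSeries Unit k)) = F := by
      rw [hF, map_sub]
      have h2 : ψ (X none) = PowerSeries.X := optionEquivLeft_X_none
      have h3 : ψ (rename some (c : MvPowerSeries Unit k)) = PowerSeries.C c :=
        optionEquivLeft_rename_some _
      rw [h2, h3]
      simp [c]
    have h2 : Associated (ψ (X none - rename some (c : MvPowerSeries Unit k))) (ψ l') := by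
      rw [h1, h.eq_mul]
      exact (associated_mul_unit_left _ _ h.isUnit).symm
    simpa using h2.map ψ.symm
  let τ : Option Unit ≃ Option Unit := Equiv.swap none (some ())
  refine ⟨(renameEquiv k σ).trans ((shiftEquiv c hc).trans ((renameEquiv k τ).trans ψ)), ?_⟩
  have h3 := ((hass.map (shiftEquiv c hc)).map (renameEquiv k τ)).map ψ
  rw [shiftEquiv_X_sub_rename] at h3
  have h4 : ψ (renameEquiv k τ (X none)) = PowerSeries.C PowerSeries.X := by
    have : renameEquiv k τ (X none) = X (some ()) := by
      refine (rename_X _ _).trans ?_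
      rw [Equiv.swap_apply_left]
    rw [this]
    exact optionEquivLeft_X_some _
  rw [h4] at h3
  exact h3

theorem MvPowerSeries.mem_maximalIdeal_sq {l : MvPowerSeries (Fin 2) k}
    (h0 : constantCoeff l = 0) (h1 : ∀ i, coeff (Finsupp.single i 1) l = 0) :
    l ∈ IsLocalRing.maximalIdeal (MvPowerSeries (Fin 2) k) ^ 2 := by
  let σ : Fin 2 ≃ Option Unit :=
    (finSuccEquiv' 0).trans (Equiv.optionCongr (Equiv.ofUnique (Fin 1) Unit))
  have hσ0 : σ 0 = none := by simp [σ]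
  have hσ1 : σ 1 = some () := by simp [σ]
  let e : MvPowerSeries (Fin 2) k ≃ₐ[k] PowerSeries (PowerSeries k) :=
    (renameEquiv k σ).trans (optionEquivLeft Unit k)
  have hX (i : Fin 2) : X i ∈ IsLocalRing.maximalIdeal (MvPowerSeries (Fin 2) k) := by
    rw [IsLocalRing.mem_maximalIdeal, mem_nonunits_iff, isUnit_iff_constantCoeff, constantCoeff_X]
    exact not_isUnit_zero
  have hXX (i j : Fin 2) (a : MvPowerSeries (Fin 2) k) :
      X i * X j * a ∈ IsLocalRing.maximalIdeal (MvPowerSeries (Fin 2) k) ^ 2 := by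
    rw [pow_two]
    exact Ideal.mul_mem_right _ _ (Ideal.mul_mem_mul (hX i) (hX j))
  have e0 : e (X 0) = PowerSeries.X := by
    have : renameEquiv k σ (X 0) = X none := (rename_X _ _).trans (by rw [hσ0])
    change optionEquivLeft Unit k (renameEquiv k σ (X 0)) = _
    rw [this]
    exact optionEquivLeft_X_none
  have e1 : e (X 1) = PowerSeries.C PowerSeries.X := by
    have : renameEquiv k σ (X 1) = X (some ()) := (rename_X _ _).trans (by rw [hσ1])
    change optionEquivLeft Unit k (renameEquiv k σ (X 1)) = _
    rw [this]
    exact optionEquivLeft_X_some _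
  obtain ⟨a, ha⟩ : PowerSeries.X ^ 2 ∣ PowerSeries.coeff 0 (e l) := by
    rw [PowerSeries.X_pow_dvd_iff]
    intro m hm
    interval_cases m
    · refine (coeff_coeff_optionEquivLeft_rename σ l (y := 0) ?_).trans h0
      ext a; cases a <;> simp
    · refine (coeff_coeff_optionEquivLeft_rename σ l (y := Finsupp.single 1 1) ?_).trans (h1 1)
      rw [Finsupp.embDomain_single]
      ext a; cases a <;> simp [hσ1]
  obtain ⟨b, hb⟩ : PowerSeries.X ∣ PowerSeries.coeff 1 (e l) := by
    rw [PowerSeries.X_dvd_iff]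
    refine (coeff_coeff_optionEquivLeft_rename σ l (y := Finsupp.single 0 1) ?_).trans (h1 0)
    rw [Finsupp.embDomain_single]
    ext a; cases a <;> simp [hσ0]
  have hl : e l = e (X 1 * X 1 * e.symm (PowerSeries.C a) + X 1 * X 0 * e.symm (PowerSeries.C b) +
      X 0 * X 0 * e.symm (PowerSeries.mk fun n ↦ PowerSeries.coeff (n + 2) (e l))) := by
    simp only [map_add, map_mul, e0, e1, AlgEquiv.apply_symm_apply]
    ext1 n
    simp only [mul_assoc]
    obtain _ | _ | n := n
    · simp [ha, pow_two, mul_assoc]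
    · simp [PowerSeries.coeff_succ_X_mul, hb]
    · simp [PowerSeries.coeff_succ_X_mul, PowerSeries.coeff_X]
  rw [e.injective hl]
  exact add_mem (add_mem (hXX _ _ _) (hXX _ _ _)) (hXX _ _ _)
end shift

theorem Ideal.finrank_quotient_span_pair_map {k A B : Type*} [Field k] [CommRing A] [CommRing B]
    [Algebra k A] [Algebra k B] (e : A ≃ₐ[k] B) (a b : A) :
    Module.finrank k (A ⧸ Ideal.span {a, b}) = Module.finrank k (B ⧸ Ideal.span {e a, e b}) :=
  (Ideal.quotientEquivAlg _ _ e (by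
    rw [Ideal.map_span, Set.image_pair]; rfl)).toLinearEquiv.finrank_eq

/-- A smooth branch is a coordinate axis in suitable coordinates. -/
theorem exists_algEquiv_associated_C_X_of_mult_eq_one {l : R}
    (hl : l ∈ IsLocalRing.maximalIdeal R) (hm : mult l = 1) :
    ∃ e : R ≃ₐ[ℂ] PowerSeries (PowerSeries ℂ), Associated (PowerSeries.C PowerSeries.X) (e l) := by
  have h0 : MvPowerSeries.constantCoeff l = 0 := by
    rwa [IsLocalRing.mem_maximalIdeal, mem_nonunits_iff, MvPowerSeries.isUnit_iff_constantCoeff,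
      isUnit_iff_ne_zero, not_not] at hl
  by_contra hne
  have h2 : l ∈ IsLocalRing.maximalIdeal R ^ 2 := by
    refine MvPowerSeries.mem_maximalIdeal_sq h0 fun i ↦ ?_
    by_contra hi
    exact hne (MvPowerSeries.exists_algEquiv_associated_C_X_of_coeff h0 hi)
  by_cases hb : BddAbove {n : ℕ | l ∈ (IsLocalRing.maximalIdeal R) ^ n}
  · have : 2 ≤ mult l := le_csSup hb h2
    omega
  · have : mult l = 0 := Nat.sSup_of_not_bddAbove hb
    omega

/-- Theorem A: the function `u_l` associated to a smooth branch `l` satisfies the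
ultrametric inequality, in multiplicative form. -/
theorem stmt2 (l f g h : R)
    (hl : Irreducible l) (hf : Irreducible f) (hg : Irreducible g) (hh : Irreducible h)
    (hlm : l ∈ IsLocalRing.maximalIdeal R)
    (hfm : f ∈ IsLocalRing.maximalIdeal R)
    (hgm : g ∈ IsLocalRing.maximalIdeal R)
    (hhm : h ∈ IsLocalRing.maximalIdeal R)
    (hlsmooth : mult l = 1)
    (hlf : ¬ Associated l f) (hlg : ¬ Associated l g) (hlh : ¬ Associated l h)
    (hfg : ¬ Associated f g) (hfh : ¬ Associated f h) (hgh : ¬ Associated g h)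
    (Hlf : FiniteDimensional ℂ (R ⧸ Ideal.span {l, f}))
    (Hlg : FiniteDimensional ℂ (R ⧸ Ideal.span {l, g}))
    (Hlh : FiniteDimensional ℂ (R ⧸ Ideal.span {l, h}))
    (Hfg : FiniteDimensional ℂ (R ⧸ Ideal.span {f, g}))
    (Hfh : FiniteDimensional ℂ (R ⧸ Ideal.span {f, h}))
    (Hgh : FiniteDimensional ℂ (R ⧸ Ideal.span {g, h})) :
    min (interNum f h * interNum l g) (interNum g h * interNum l f) ≤
      interNum f g * interNum l h := by
  obtain ⟨e, he⟩ := exists_algEquiv_associated_C_X_of_mult_eq_one hlm hlsmooth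
  have irr {a : R} (ha : Irreducible a) : Irreducible (e a) := (MulEquiv.irreducible_iff e).2 ha
  have ass {a b : R} (hab : ¬ Associated a b) : ¬ Associated (e a) (e b) :=
    fun H ↦ hab (by simpa using H.map e.symm)
  have assX {a : R} (ha : ¬ Associated l a) :
      ¬ Associated (PowerSeries.C PowerSeries.X) (e a) :=
    fun H ↦ ass ha (he.symm.trans H)
  have hX (a : R) : interNum l a = Module.finrank ℂ (PowerSeries (PowerSeries ℂ) ⧸
      Ideal.span {PowerSeries.C PowerSeries.X, e a}) := by
    rw [interNum, Ideal.finrank_quotient_span_pair_map e,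
      Ideal.span_pair_eq_of_associated he.symm (Associated.refl (e a))]
  have hI (a b : R) : interNum a b = Module.finrank ℂ (PowerSeries (PowerSeries ℂ) ⧸
      Ideal.span {e a, e b}) := Ideal.finrank_quotient_span_pair_map e a b
  rw [hX, hX, hX, hI, hI, hI]
  exact PowerSeries.min_finrank_mul_finrank_le (irr hf) (irr hg) (irr hh) (ass hfg) (ass hfh)
    (ass hgh) (assX hlf) (assX hlg) (assX hlh)
end

section
/- Let X be a finite nonempty set and d a metric on X. Then the following are equivalent: (a) d satisfies the four points condition, i.e., for all a, b, c, e ∈ X, d(a,b) + d(c,e) ≤ max( d(a,c) + d(b,e), d(a,e) + d(b,c) ); (b) d is induced by a nonnegative length function on a finite tree containing X among its vertices, i.e., there exist a finite type V, a simple graph T on V which is a tree, a nonnegative weight function w on the edges of T, and an injection ι : X → V, such that for all a, b ∈ X and every path p in T from ι(a) to ι(b), d(a,b) equals the sum of the weights w of the edges of p. -/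
namespace SimpleGraph

variable {V : Type*}

/-- `IsRooting T r f depth` says that `r` is a root of `T` at depth zero and that every other vertex
`v` is adjacent to its parent `f v`, which has smaller depth. -/
structure IsRooting (T : SimpleGraph V) (r : V) (f : V → V) (depth : V → ℕ) : Prop where
  depth_root : depth r = 0
  adj : ∀ v, v ≠ r → T.Adj v (f v)
  depth_lt : ∀ v, v ≠ r → depth (f v) < depth v

theorem Connected.exists_isRooting {T : SimpleGraph V} (hT : T.Connected) (r : V) :
    ∃ f, T.IsRooting r f (fun v => T.dist v r) := by
  have key : ∀ v, ∃ u, v ≠ r → T.Adj v u ∧ T.dist u r < T.dist v r := by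
    intro v
    obtain ⟨p, hp⟩ := hT.exists_walk_length_eq_dist v r
    cases p with
    | nil => exact ⟨r, fun h => absurd rfl h⟩
    | cons h q =>
      refine ⟨_, fun _ => ⟨h, ?_⟩⟩
      have := dist_le q
      rw [Walk.length_cons] at hp
      omega
  choose f hf using key
  exact ⟨f, dist_self, fun v hv => (hf v hv).1, fun v hv => (hf v hv).2⟩

namespace IsRooting

variable {T : SimpleGraph V} {r : V} {f : V → V} {depth : V → ℕ}

theorem ne_root (h : T.IsRooting r f depth) {u v : V} (huv : u ≠ v) (hd : depth u ≤ depth v) :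
    v ≠ r := by
  rintro rfl
  have := h.depth_lt u huv
  have := h.depth_root
  omega

theorem exists_isPath (h : T.IsRooting r f depth) (u v : V) :
    ∃ p : T.Walk u v, p.IsPath ∧
      ∀ x ∈ p.support, x ≠ u → x ≠ v → depth x < max (depth u) (depth v) := by
  induction hn : depth u + depth v using Nat.strong_induction_on generalizing u v with
  | _ n ih =>
    have step : ∀ u v : V, depth u + depth v = n → u ≠ v → depth u ≤ depth v →
        ∃ p : T.Walk u v, p.IsPath ∧
          ∀ x ∈ p.support, x ≠ u → x ≠ v → depth x < max (depth u) (depth v) := by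
      intro u v hn huv hd
      have hv := h.ne_root huv hd
      have hlt := h.depth_lt v hv
      obtain ⟨q, hq, hqs⟩ := ih _ (by omega) u (f v) rfl
      refine ⟨q.concat (h.adj v hv).symm, hq.concat (fun hmem => ?_) _, fun x hx hxu hxv => ?_⟩
      · have := hqs v hmem huv.symm (h.adj v hv).ne
        omega
      · rw [Walk.support_concat, List.mem_append, List.mem_singleton] at hx
        obtain hx | hx := hx
        · by_cases hxf : x = f v
          · subst hxf
            omega
          · have := hqs x hx hxu hxf
            omega
        · exact absurd hx hxv
    by_cases huv : u = v
    · subst huv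
      exact ⟨Walk.nil, Walk.IsPath.nil, fun x hx hxu => absurd (by simpa using hx) hxu⟩
    · obtain hd | hd := le_total (depth u) (depth v)
      · exact step u v hn huv hd
      · obtain ⟨p, hp, hps⟩ := step v u (by omega) (Ne.symm huv) hd
        refine ⟨p.reverse, hp.reverse, fun x hx hxu hxv => ?_⟩
        rw [max_comm]
        exact hps x (by simpa using hx) hxv hxu

theorem connected (h : T.IsRooting r f depth) : T.Connected :=
  have : Nonempty V := ⟨r⟩
  ⟨fun u v => (h.exists_isPath u v).elim fun p _ => p.reachable⟩

end IsRooting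

/-- The graph joining every vertex to its image under `f`. -/
def parentGraph (f : V → V) : SimpleGraph V := fromRel fun u v => f u = v

theorem isRooting_parentGraph {r : V} {f : V → V} {depth : V → ℕ} (hr : depth r = 0)
    (hf : ∀ v, v ≠ r → depth (f v) < depth v) : (parentGraph f).IsRooting r f depth where
  depth_root := hr
  adj v hv := by
    rw [parentGraph, fromRel_adj]
    refine ⟨fun hvf => ?_, Or.inl rfl⟩
    have := hf v hv
    rw [← hvf] at this
    exact lt_irrefl _ this
  depth_lt := hf

theorem isTree_parentGraph [Finite V] {r : V} {f : V → V} {depth : V → ℕ} (hr : depth r = 0)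
    (hfr : f r = r) (hf : ∀ v, v ≠ r → depth (f v) < depth v) : (parentGraph f).IsTree := by
  have hc := (isRooting_parentGraph hr hf).connected
  refine isTree_iff_connected_and_card.2 ⟨hc, le_antisymm ?_ hc.card_vert_le_card_edgeSet_add_one⟩
  have hsub : (parentGraph f).edgeSet ⊆ (fun v => s(v, f v)) '' {r}ᶜ := by
    intro e
    induction e with
    | _ u v =>
      rw [mem_edgeSet, parentGraph, fromRel_adj]
      rintro ⟨huv, rfl | rfl⟩
      · exact ⟨u, fun hu => huv (by rw [Set.mem_singleton_iff.1 hu, hfr]), rfl⟩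
      · exact ⟨v, fun hv => huv (by rw [Set.mem_singleton_iff.1 hv, hfr]), Sym2.eq_swap⟩
  have h1 := Set.ncard_le_ncard hsub (Set.toFinite _)
  have h2 := Set.ncard_image_le (f := fun v => s(v, f v)) (Set.toFinite ({r}ᶜ : Set V))
  have h3 := Set.ncard_add_ncard_compl ({r} : Set V)
  rw [Set.ncard_singleton] at h3
  rw [Nat.card_coe_set_eq]
  omega

/-- The sum of the weights of the edges on the path from `u` to `v` in a tree. -/
noncomputable def IsTree.pathWeight {T : SimpleGraph V} (hT : T.IsTree) (w : Sym2 V → ℝ)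
    (u v : V) : ℝ :=
  ((hT.existsUnique_path u v).choose.edges.map w).sum

namespace IsTree

variable {T : SimpleGraph V} (hT : T.IsTree) (w : Sym2 V → ℝ)

theorem pathWeight_eq {u v : V} (p : T.Walk u v) (hp : p.IsPath) :
    hT.pathWeight w u v = (p.edges.map w).sum := by
  rw [(hT.existsUnique_path u v).choose_spec.2 p hp, pathWeight]

theorem pathWeight_self (u : V) : hT.pathWeight w u u = 0 := by
  simp [hT.pathWeight_eq w (Walk.nil : T.Walk u u) Walk.IsPath.nil]

theorem pathWeight_comm (u v : V) : hT.pathWeight w u v = hT.pathWeight w v u := by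
  obtain ⟨p, hp, -⟩ := hT.existsUnique_path u v
  rw [hT.pathWeight_eq w p hp, hT.pathWeight_eq w p.reverse hp.reverse, Walk.edges_reverse,
    List.map_reverse, List.sum_reverse]

theorem pathWeight_nonneg (hw : ∀ e, 0 ≤ w e) (u v : V) : 0 ≤ hT.pathWeight w u v := by
  refine List.sum_nonneg fun x hx => ?_
  obtain ⟨e, -, rfl⟩ := List.mem_map.1 hx
  exact hw e

theorem pathWeight_eq_add_parent {r : V} {f : V → V} {depth : V → ℕ}
    (h : T.IsRooting r f depth) {u v : V} (huv : u ≠ v) (hd : depth u ≤ depth v) :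
    hT.pathWeight w u v = w s(v, f v) + hT.pathWeight w u (f v) := by
  have hv := h.ne_root huv hd
  have hlt := h.depth_lt v hv
  obtain ⟨q, hq, hqs⟩ := h.exists_isPath u (f v)
  have hmem : v ∉ q.support := fun hmem => by
    have := hqs v hmem huv.symm (h.adj v hv).ne
    omega
  rw [hT.pathWeight_eq w q hq,
    hT.pathWeight_eq w _ (hq.concat hmem (h.adj v hv).symm), Walk.edges_concat, Sym2.eq_swap]
  simp [add_comm]

end IsTree

end SimpleGraph

section Recursion

variable {V : Type*} {D : V → V → ℝ} {c : V → ℝ} {f : V → V} {depth : V → ℕ}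

theorem triangle_of_parent_recursion (hself : ∀ u, D u u = 0) (hcomm : ∀ u v, D u v = D v u)
    (hnonneg : ∀ u v, 0 ≤ D u v) (hc : ∀ v, 0 ≤ c v)
    (hrec : ∀ u v, u ≠ v → depth u ≤ depth v → depth (f v) < depth v ∧ D u v = c v + D u (f v))
    (x y z : V) : D x z ≤ D x y + D y z := by
  induction hn : depth x + depth y + depth z using Nat.strong_induction_on
    generalizing x y z with
  | _ n ih =>
    by_cases hxy : x = y
    · subst hxy
      simp [hself]
    by_cases hyz : y = z
    · subst hyz
      simp [hself]
    by_cases hxz : x = z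
    · subst hxz
      rw [hself]
      exact add_nonneg (hnonneg _ _) (hnonneg _ _)
    have hcases : (depth y ≤ depth x ∧ depth z ≤ depth x) ∨
        (depth x ≤ depth y ∧ depth z ≤ depth y) ∨
        (depth x ≤ depth z ∧ depth y ≤ depth z) := by omega
    obtain ⟨h1, h2⟩ | ⟨h1, h2⟩ | ⟨h1, h2⟩ := hcases
    · obtain ⟨hlt, e1⟩ := hrec y x (Ne.symm hxy) h1
      obtain ⟨-, e2⟩ := hrec z x (Ne.symm hxz) h2
      have := ih _ (by omega) (f x) y z rfl
      linarith [hcomm x z, hcomm x y, hcomm (f x) z, hcomm (f x) y]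
    · obtain ⟨hlt, e1⟩ := hrec x y hxy h1
      obtain ⟨-, e2⟩ := hrec z y (Ne.symm hyz) h2
      have := ih _ (by omega) x (f y) z rfl
      linarith [hcomm y z, hcomm (f y) z, hc y]
    · obtain ⟨hlt, e1⟩ := hrec x z hxz h1
      obtain ⟨-, e2⟩ := hrec y z hyz h2
      have := ih _ (by omega) x y (f z) rfl
      linarith

theorem four_points_of_parent_recursion (hself : ∀ u, D u u = 0) (hcomm : ∀ u v, D u v = D v u)
    (hnonneg : ∀ u v, 0 ≤ D u v) (hc : ∀ v, 0 ≤ c v)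
    (hrec : ∀ u v, u ≠ v → depth u ≤ depth v → depth (f v) < depth v ∧ D u v = c v + D u (f v))
    (x y z t : V) : D x y + D z t ≤ max (D x z + D y t) (D x t + D y z) := by
  have htri := triangle_of_parent_recursion hself hcomm hnonneg hc hrec
  induction hn : depth x + depth y + depth z + depth t using Nat.strong_induction_on
    generalizing x y z t with
  | _ n ih =>
    have step : ∀ x y z t : V, depth x + depth y + depth z + depth t = n →
        depth y ≤ depth x → depth z ≤ depth x → depth t ≤ depth x →
        D x y + D z t ≤ max (D x z + D y t) (D x t + D y z) := by
      intro x y z t hn hy hz ht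
      by_cases hxy : x = y
      · subst hxy
        rw [le_max_iff]
        left
        linarith [htri z x t, hself x, hcomm z x]
      by_cases hxz : x = z
      · subst hxz
        rw [le_max_iff]
        right
        linarith [hcomm x y]
      by_cases hxt : x = t
      · subst hxt
        rw [le_max_iff]
        left
        linarith [hcomm x y, hcomm x z]
      obtain ⟨hlt, e1⟩ := hrec y x (Ne.symm hxy) hy
      obtain ⟨-, e2⟩ := hrec z x (Ne.symm hxz) hz
      obtain ⟨-, e3⟩ := hrec t x (Ne.symm hxt) ht
      have := ih _ (by omega) (f x) y z t rfl
      rw [hcomm x y, hcomm x z, hcomm x t, e1, e2, e3, hcomm y, hcomm z (f x), hcomm t,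
        add_assoc, add_assoc, add_assoc, max_add_add_left]
      linarith
    have hcases : (depth y ≤ depth x ∧ depth z ≤ depth x ∧ depth t ≤ depth x) ∨
        (depth x ≤ depth y ∧ depth z ≤ depth y ∧ depth t ≤ depth y) ∨
        (depth x ≤ depth z ∧ depth y ≤ depth z ∧ depth t ≤ depth z) ∨
        (depth x ≤ depth t ∧ depth y ≤ depth t ∧ depth z ≤ depth t) := by omega
    obtain ⟨h1, h2, h3⟩ | ⟨h1, h2, h3⟩ | ⟨h1, h2, h3⟩ | ⟨h1, h2, h3⟩ := hcases
    · exact step x y z t hn h1 h2 h3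
    · have := step y x z t (by omega) h1 h2 h3
      rwa [hcomm y x, add_comm (D y z), add_comm (D y t), max_comm] at this
    · have := step z t x y (by omega) h3 h1 h2
      rwa [add_comm (D z t), hcomm z x, hcomm t y, hcomm z y, hcomm t x, add_comm (D y z)] at this
    · have := step t z x y (by omega) h3 h1 h2
      rwa [add_comm (D t z), hcomm t z, hcomm z y, hcomm t x, hcomm t y, hcomm z x, max_comm,
        add_comm (D y t)] at this

end Recursion

theorem exists_monotone_levels {S : Set ℝ} (hS : S.Finite) (hS0 : (0 : ℝ) ∈ S)
    (hSpos : ∀ x ∈ S, 0 ≤ x) :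
    ∃ (n : ℕ) (h : ℕ → ℝ), Monotone h ∧ h 0 = 0 ∧ ∀ x ∈ S, ∃ k ≤ n, h k = x := by
  classical
  obtain ⟨n, hn⟩ : ∃ n, hS.toFinset.card = n + 1 :=
    Nat.exists_eq_succ_of_ne_zero (Finset.card_ne_zero_of_mem (hS.mem_toFinset.2 hS0))
  let e := hS.toFinset.orderIsoOfFin hn
  have hsurj : ∀ x ∈ S, ∃ k : Fin (n + 1), (e k : ℝ) = x := fun x hx =>
    ⟨e.symm ⟨x, hS.mem_toFinset.2 hx⟩, by simp⟩
  refine ⟨n, fun i => e ⟨min i n, by omega⟩, fun i j hij => ?_, le_antisymm ?_ ?_, fun x hx => ?_⟩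
  · exact e.monotone (Fin.mk_le_mk.2 (min_le_min_right n hij))
  · obtain ⟨k, hk⟩ := hsurj 0 hS0
    rw [← hk]
    exact e.monotone (Fin.mk_le_mk.2 (by omega))
  · exact hSpos _ (hS.mem_toFinset.1 (e _).2)
  · obtain ⟨k, hk⟩ := hsurj x hx
    refine ⟨k, by omega, ?_⟩
    have hmin : (⟨min k.val n, by omega⟩ : Fin (n + 1)) = k := Fin.ext (by dsimp only; omega)
    rw [← hk]
    exact congrArg (fun i => (e i : ℝ)) hmin

/-- For a symmetric similarity `g` with the ultrametric property, the points `(a, i)` and `(b, i)`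
of the strings ending at the elements of `X` are identified when the level `h i` is at most
`g a b`. -/
def stringSetoid {X : Type*} (g : X → X → ℝ) (h : ℕ → ℝ) (n : ℕ)
    (hcomm : ∀ a b, g a b = g b a) (hultra : ∀ a b c, min (g a b) (g b c) ≤ g a c) :
    Setoid (X × Fin (n + 1)) where
  r p q := p.2 = q.2 ∧ (p.1 = q.1 ∨ h p.2 ≤ g p.1 q.1)
  iseqv :=
    { refl := fun _ => ⟨rfl, Or.inl rfl⟩
      symm := by
        rintro ⟨a, i⟩ ⟨b, j⟩ ⟨hij, hab⟩
        dsimp only at hij hab ⊢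
        subst hij
        rw [hcomm b a]
        exact ⟨rfl, hab.imp Eq.symm id⟩
      trans := by
        rintro ⟨a, i⟩ ⟨b, j⟩ ⟨c, k⟩ ⟨hij, hab⟩ ⟨hjk, hbc⟩
        dsimp only at hij hab hjk hbc ⊢
        subst hij hjk
        refine ⟨rfl, ?_⟩
        obtain rfl | hab := hab
        · exact hbc
        obtain rfl | hbc := hbc
        · exact Or.inr hab
        exact Or.inr ((le_min hab hbc).trans (hultra a b c)) }

theorem exists_tree_of_similarity {X : Type} [Finite X] (r : X) (g : X → X → ℝ)
    (hcomm : ∀ a b, g a b = g b a) (hultra : ∀ a b c, min (g a b) (g b c) ≤ g a c)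
    (hnonneg : ∀ a b, 0 ≤ g a b) (hdiag : ∀ a b, g a b ≤ g a a) (hr : g r r = 0) :
    ∃ (V : Type) (_ : Fintype V) (T : SimpleGraph V) (w : Sym2 V → ℝ) (ι : X → V),
      T.IsTree ∧ (∀ e, 0 ≤ w e) ∧
      ∀ (a b : X) (p : T.Walk (ι a) (ι b)), p.IsPath →
        g a a + g b b - 2 * g a b = (p.edges.map w).sum := by
  obtain ⟨n, h, hmono, h0, hlev⟩ := exists_monotone_levels
    (Set.finite_range fun p : X × X => g p.1 p.2) ⟨(r, r), hr⟩
    (by rintro _ ⟨p, rfl⟩; exact hnonneg _ _)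
  replace hlev : ∀ a b, ∃ k ≤ n, h k = g a b := fun a b => hlev _ ⟨(a, b), rfl⟩
  let S := stringSetoid g h n hcomm hultra
  let V := Quotient S
  let mk : X → Fin (n + 1) → V := fun a i => Quotient.mk S (a, i)
  have mk_eq : ∀ a b i j, mk a i = mk b j ↔ i = j ∧ (a = b ∨ h i ≤ g a b) := fun a b i j =>
    Quotient.eq
  let depth : V → ℕ := Quotient.lift (fun p => p.2.val) fun p q hpq => congrArg Fin.val hpq.1
  let f : V → V := Quotient.map (fun p => (p.1, ⟨p.2.val - 1, by omega⟩)) (by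
    rintro ⟨a, i⟩ ⟨b, j⟩ ⟨hij, hab⟩
    dsimp only at hij hab
    subst hij
    exact ⟨rfl, hab.imp id fun hab => (hmono (Nat.sub_le _ _)).trans hab⟩)
  have f_mk : ∀ a i, f (mk a i) = mk a ⟨i.val - 1, by omega⟩ := fun _ _ => rfl
  have depth_mk : ∀ a i, depth (mk a i) = i.val := fun _ _ => rfl
  have hroot : ∀ v, depth v = 0 → v = mk r 0 := by
    intro v
    induction v using Quotient.inductionOn with
    | _ p =>
      obtain ⟨a, i⟩ := p
      intro hi
      have hi : i = 0 := Fin.ext hi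
      subst hi
      exact (mk_eq a r 0 0).2 ⟨rfl, Or.inr (by simpa [h0] using hnonneg a r)⟩
  have hlt : ∀ v, v ≠ mk r 0 → depth (f v) < depth v := by
    intro v hv
    have hv : depth v ≠ 0 := fun h => hv (hroot v h)
    induction v using Quotient.inductionOn with
    | _ p => exact Nat.sub_one_lt hv
  have hT := SimpleGraph.isTree_parentGraph (depth_mk r 0) (hroot _ rfl) hlt
  have hR := SimpleGraph.isRooting_parentGraph (depth_mk r 0) hlt
  let w : Sym2 V → ℝ :=
    Sym2.lift ⟨fun u v => |h (depth u) - h (depth v)|, fun _ _ => abs_sub_comm _ _⟩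
  have hw : ∀ u v, w s(u, v) = |h (depth u) - h (depth v)| := fun _ _ => rfl
  have key : ∀ (m : ℕ) (a b : X) (i j : Fin (n + 1)), i.val + j.val = m →
      h i ≤ g a a → h j ≤ g b b →
      hT.pathWeight w (mk a i) (mk b j) = h i + h j - 2 * min (min (h i) (h j)) (g a b) := by
    intro m
    induction m using Nat.strong_induction_on with
    | _ m ih =>
      have step : ∀ (a b : X) (i j : Fin (n + 1)), i.val + j.val = m → h i ≤ g a a → h j ≤ g b b →
          mk a i ≠ mk b j → i.val ≤ j.val → hT.pathWeight w (mk a i) (mk b j) =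
            h i + h j - 2 * min (min (h i) (h j)) (g a b) := by
        intro a b i j hm hi hj hne hij
        have hj0 : j.val ≠ 0 := fun hj0 => hR.ne_root hne hij (hroot _ hj0)
        have hle : h (j.val - 1) ≤ h j := hmono (Nat.sub_le _ _)
        rw [hT.pathWeight_eq_add_parent w hR hne hij, hw, f_mk, depth_mk, depth_mk,
          ih _ (by dsimp only; omega) a b i ⟨j.val - 1, by omega⟩ rfl hi (hle.trans hj),
          abs_of_nonneg (sub_nonneg.2 hle)]
        have hmin : min (min (h i) (h (j.val - 1))) (g a b) = min (min (h i) (h j)) (g a b) := by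
          rcases hij.lt_or_eq with hlt | heq
          · rw [min_eq_left (hmono (by omega : i.val ≤ j.val - 1)), min_eq_left (hmono hij)]
          · have hg : g a b < h i := by
              by_contra! hcon
              exact hne ((mk_eq _ _ _ _).2 ⟨Fin.ext heq, Or.inr hcon⟩)
            obtain ⟨k, -, hk⟩ := hlev a b
            have hki : k < i.val := by
              by_contra! hcon
              exact absurd (hmono hcon) (by rw [hk]; exact not_le.2 hg)
            have : g a b ≤ h (j.val - 1) := by
              rw [← hk]
              exact hmono (by omega)
            rw [min_eq_right (le_min hg.le this), min_eq_right (le_min hg.le (this.trans hle))]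
        dsimp only
        rw [hmin]
        ring
      intro a b i j hm hi hj
      by_cases heq : mk a i = mk b j
      · rw [heq, hT.pathWeight_self]
        obtain ⟨rfl, hab⟩ := (mk_eq _ _ _ _).1 heq
        have : h i ≤ g a b := by
          obtain rfl | hab := hab
          · exact hi
          · exact hab
        rw [min_self, min_eq_left this]
        ring
      · obtain hij | hij := le_total i.val j.val
        · exact step a b i j hm hi hj heq hij
        · rw [hT.pathWeight_comm, step b a j i (by omega) hj hi (Ne.symm heq) hij, hcomm b a,
            min_comm (h j)]
          ring
  choose k hkn hk using fun a => hlev a a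
  refine ⟨V, Fintype.ofFinite V, _, w, fun a => mk a ⟨k a, by have := hkn a; omega⟩, hT, ?_, ?_⟩
  · intro e
    induction e with
    | _ u v => exact abs_nonneg _
  · intro a b p hp
    rw [← hT.pathWeight_eq w p hp, key _ a b _ _ rfl (hk a).le (hk b).le]
    dsimp only
    rw [hk, hk, min_eq_right (le_min (hdiag a b) (hcomm a b ▸ hdiag b a))]

/-- The similarity used here is the Gromov product based at a point of `X`: the four points condition
makes it ultrametric. -/
theorem exists_tree_of_four_points {X : Type} [Finite X] [Nonempty X] (d : X → X → ℝ)
    (hself : ∀ a, d a a = 0) (hcomm : ∀ a b, d a b = d b a)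
    (htri : ∀ a b c, d a c ≤ d a b + d b c)
    (hfour : ∀ a b c e : X, d a b + d c e ≤ max (d a c + d b e) (d a e + d b c)) :
    ∃ (V : Type) (_ : Fintype V) (T : SimpleGraph V) (w : Sym2 V → ℝ) (ι : X → V),
      T.IsTree ∧ (∀ e, 0 ≤ w e) ∧
      ∀ (a b : X) (p : T.Walk (ι a) (ι b)), p.IsPath → d a b = (p.edges.map w).sum := by
  obtain ⟨r⟩ := ‹Nonempty X›
  obtain ⟨V, hV, T, w, ι, hT, hw, hp⟩ := exists_tree_of_similarity r
    (fun a b => (d r a + d r b - d a b) / 2)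
    (fun a b => by rw [hcomm a b, add_comm (d r a)])
    (fun a b c => by
      rw [min_le_iff]
      rcases le_max_iff.1 (hfour a c b r) with h | h
      · left
        linarith [hcomm b r, hcomm c r, hcomm a r]
      · right
        linarith [hcomm b r, hcomm c r, hcomm a r, hcomm b c])
    (fun a b => by linarith [htri a r b, hcomm a r])
    (fun a b => by linarith [htri r a b, hself a])
    (by simp [hself])
  refine ⟨V, hV, T, w, ι, hT, hw, fun a b p hpath => ?_⟩
  rw [← hp a b p hpath, hself, hself]
  ring

/-- Buneman's four points characterization of tree metrics: a metric on a finite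
nonempty set satisfies the four points condition iff it is induced by a nonnegative
length function on the edges of a finite tree containing the set among its vertices. -/
theorem stmt19 (X : Type*) [Finite X] [Nonempty X] (d : X → X → ℝ)
    (hpos : ∀ a b : X, 0 ≤ d a b)
    (hzero : ∀ a b : X, d a b = 0 ↔ a = b)
    (hdsymm : ∀ a b : X, d a b = d b a)
    (htri : ∀ a b c : X, d a c ≤ d a b + d b c) :
    (∀ a b c e : X, d a b + d c e ≤ max (d a c + d b e) (d a e + d b c)) ↔
      (∃ (V : Type) (_ : Fintype V) (T : SimpleGraph V) (w : Sym2 V → ℝ) (ι : X → V),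
        T.IsTree ∧ Function.Injective ι ∧ (∀ e, 0 ≤ w e) ∧
        ∀ (a b : X) (p : T.Walk (ι a) (ι b)), p.IsPath →
          d a b = (p.edges.map w).sum) := by
  constructor
  · intro hfour
    obtain ⟨n, ⟨e⟩⟩ := Finite.exists_equiv_fin X
    have : Nonempty (Fin n) := ‹Nonempty X›.map e
    obtain ⟨V, hV, T, w, ι, hT, hw, hp⟩ := exists_tree_of_four_points
      (fun i j : Fin n => d (e.symm i) (e.symm j)) (fun _ => (hzero _ _).2 rfl)
      (fun _ _ => hdsymm _ _) (fun _ _ _ => htri _ _ _) (fun _ _ _ _ => hfour _ _ _ _)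
    have hd : ∀ (a b : X) (p : T.Walk (ι (e a)) (ι (e b))), p.IsPath →
        d a b = (p.edges.map w).sum := fun a b p hpath => by
      simpa using hp (e a) (e b) p hpath
    refine ⟨V, hV, T, w, fun a => ι (e a), hT, fun a b hab => ?_, hw, hd⟩
    have := hd a b (SimpleGraph.Walk.nil.copy rfl hab) (by simp)
    exact (hzero a b).1 (by simpa using this)
  · rintro ⟨V, _, T, w, ι, hT, -, hw, hp⟩ a b c e
    have hd : ∀ a b, d a b = hT.pathWeight w (ι a) (ι b) := fun a b => by
      obtain ⟨p, hpath, -⟩ := hT.existsUnique_path (ι a) (ι b)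
      rw [hp a b p hpath, hT.pathWeight_eq w p hpath]
    obtain ⟨f, hf⟩ := hT.connected.exists_isRooting (ι a)
    simp only [hd]
    exact four_points_of_parent_recursion (hT.pathWeight_self w) (hT.pathWeight_comm w)
      (hT.pathWeight_nonneg w hw) (fun v => hw s(v, f v))
      (fun u v huv hle => ⟨hf.depth_lt v (hf.ne_root huv hle),
        hT.pathWeight_eq_add_parent w hf huv hle⟩) _ _ _ _
end
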